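/- Let U be a subunital of order q of the generalized hermitian unital H(C|R), where q ≥ 2 is an integer. Then q is a prime power, and there exist a subfield E of C with exactly q² elements such that F := E ∩ R has exactly q elements, an element ε' ∈ E \ F, and an invertible 3×3 matrix g over C such that U = { [g·(x,y,z)ᵀ] ∈ PG(2,C) : (x,y,z) ∈ E³ \ {0} with x^q·y + z^{q+1} ∈ ε'·F }. In other words, the embedding of U into H(C|R) is standard: up to a projective transformation of PG(2,C), U is the image under the coordinatewise inclusion E ⊆ C of the point set of the hermitian unital H(E|F). -/

import Mathlib

noncomputable section

/-- A line of the projective plane `PG(2,C)`: the zero set of a nonzero linear form. -/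
def IsLine (C : Type*) [Field C] (ℓ : Set (Projectivization C (Fin 3 → C))) : Prop :=
  ∃ f : (Fin 3 → C) →ₗ[C] C, f ≠ 0 ∧ ℓ = {P : Projectivization C (Fin 3 → C) | f P.rep = 0}

/-- The point set of the generalized hermitian unital `H(C|R)`:
points `[X,Y,Z]` with `σ(X)·Y + σ(Z)·Z ∈ εR`. -/
def hermSet {C : Type*} [Field C] (R : Subfield C) (σ : C →+* C) (ε : C) :
    Set (Projectivization C (Fin 3 → C)) :=
  {P | ∃ v : Fin 3 → C, ∃ hv : v ≠ 0, P = Projectivization.mk C v hv ∧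
        ∃ r ∈ R, σ (v 0) * v 1 + σ (v 2) * v 2 = ε * r}

/-- A block of `H(C|R)`: the trace of a line meeting the point set in at least two points. -/
def IsHermBlock {C : Type*} [Field C] (R : Subfield C) (σ : C →+* C) (ε : C)
    (B : Set (Projectivization C (Fin 3 → C))) : Prop :=
  ∃ ℓ, IsLine C ℓ ∧ (hermSet R σ ε ∩ ℓ).Nontrivial ∧ B = hermSet R σ ε ∩ ℓ

/-- A subunital of order `q` of `H(C|R)`: a set `U` of `q³ + 1` points of the unital
such that every block containing at least two points of `U` contains exactly
`q + 1` points of `U`. -/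
def IsSubunital {C : Type*} [Field C] (R : Subfield C) (σ : C →+* C) (ε : C)
    (q : ℕ) (U : Set (Projectivization C (Fin 3 → C))) : Prop :=
  U ⊆ hermSet R σ ε ∧ U.ncard = q ^ 3 + 1 ∧
    ∀ B, IsHermBlock R σ ε B → (B ∩ U).Nontrivial → (B ∩ U).ncard = q + 1

theorem mul_mem_of_inv_closed {C : Type*} [Field C] (T : AddSubgroup C) (hfin : (T : Set C).Finite)
    (h1 : (1 : C) ∈ T) (hinv : ∀ x ∈ T, x⁻¹ ∈ T) {a b : C} (ha : a ∈ T) (hb : b ∈ T) :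
    a * b ∈ T := by
  have hua : ∀ a ∈ T, ∀ b ∈ T, a * a * b ∈ T := by
    intro a ha b hb
    rcases eq_or_ne a 0 with rfl | ha0
    · simp
    rcases eq_or_ne b 0 with rfl | hb0
    · simp
    rcases eq_or_ne (1 - a * b) 0 with hab | hab
    · have : a * a * b = a := by linear_combination (-a) * hab
      rwa [this]
    have hba : b⁻¹ - a ≠ 0 := by
      intro h
      apply hab
      have : b * (b⁻¹ - a) = 0 := by rw [h, mul_zero]
      rw [mul_sub, mul_inv_cancel₀ hb0] at this
      linear_combination this
    have key : a⁻¹ + (b⁻¹ - a)⁻¹ = (a - a * a * b)⁻¹ := by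
      have e1 : b⁻¹ - a = (1 - a * b) * b⁻¹ := by field_simp
      have e2 : a - a * a * b = a * (1 - a * b) := by ring
      rw [e1, e2]
      field_simp
      ring
    have := hinv _ (T.add_mem (hinv a ha) (hinv _ (T.sub_mem (hinv b hb) ha)))
    rw [key, inv_inv] at this
    simpa using T.sub_mem ha this
  by_cases h2 : (2 : C) = 0
  · have : Finite T := hfin
    have hinj : Function.Injective (fun x : T => (⟨x * x, by simpa using hua x x.2 1 h1⟩ : T)) := by
      intro x y hxy
      have hxy' : (x : C) * x = y * y := congrArg Subtype.val hxy
      have : ((x : C) - y) * (x - y) = 0 := by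
        linear_combination hxy' + ((y : C) * y - x * y) * h2
      exact Subtype.ext (sub_eq_zero.mp (mul_self_eq_zero.mp this))
    obtain ⟨c, hc⟩ := (Finite.injective_iff_surjective.mp hinj) ⟨a, ha⟩
    have hc' : (c : C) * c = a := congrArg Subtype.val hc
    rw [← hc']
    exact hua c c.2 b hb
  · have h2T : (2 : C) ∈ T := by
      have := T.add_mem h1 h1
      rwa [one_add_one_eq_two] at this
    have hq : a * (2⁻¹ * 2⁻¹) ∈ T := by
      have := hua _ (hinv _ h2T) a ha
      rwa [mul_comm] at this
    have hh : a * 2⁻¹ ∈ T := by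
      have := T.add_mem hq hq
      have e : a * (2⁻¹ * 2⁻¹) + a * (2⁻¹ * 2⁻¹) = a * 2⁻¹ := by field_simp; ring
      rwa [e] at this
    have h3 := T.sub_mem (T.sub_mem (hua _ (T.add_mem hh h1) b hb) (hua _ hh b hb)) (hua _ h1 b hb)
    have e : (a * 2⁻¹ + 1) * (a * 2⁻¹ + 1) * b - a * 2⁻¹ * (a * 2⁻¹) * b - 1 * 1 * b = a * b := by
      field_simp; ring
    rwa [e] at h3

/-- The properties of the generator of `Aut_R(C)`, for a quadratic extension `C|R`,
that do not refer to a chosen generator of the extension. -/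
structure IsQuadConj {C : Type*} [Field C] (R : Subfield C) (σ : C →+* C) : Prop where
  fix : ∀ r ∈ R, σ r = r
  trace_mem : ∀ z, z + σ z ∈ R
  norm_mem : ∀ z, σ z * z ∈ R
  invol : ∀ z, σ (σ z) = z

/-- The affine part of a subunital of `H(C|R)` containing the point `[0,1,0]`. -/
structure IsAffineSubunital {C : Type*} [Field C] (R : Subfield C) (σ : C →+* C) (ε : C) (q : ℕ)
    (S : Set (C × C)) : Prop where
  herm : ∀ y z, (y, z) ∈ S → ∃ r ∈ R, y + σ z * z = ε * r
  card : S.ncard = q ^ 3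
  fibre : ∀ y z, (y, z) ∈ S → {y' | (y', z) ∈ S}.ncard = q
  block : ∀ a y z, (y, z) ∈ S → ∀ z', z' ≠ z → (y + a * (z' - z), z') ∈ S →
    {x | (y + a * (x - z), x) ∈ S}.ncard = q + 1

namespace IsAffineSubunital

variable {C : Type*} [Field C] {R : Subfield C} {σ : C →+* C} {ε : C} {q : ℕ} {S : Set (C × C)}

theorem finite (hS : IsAffineSubunital R σ ε q S) (hq : 2 ≤ q) : S.Finite := by
  apply Set.finite_of_ncard_ne_zero
  rw [hS.card]
  positivity

theorem ncard_image_snd (hS : IsAffineSubunital R σ ε q S) (hq : 2 ≤ q) :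
    (Prod.snd '' S).ncard = q ^ 2 := by
  classical
  have hfin := hS.finite hq
  have h1 : hfin.toFinset.card = q ^ 3 := by
    rw [← hS.card, Set.ncard_eq_toFinset_card _ hfin]
  have h2 : (Prod.snd '' S).ncard = (hfin.toFinset.image Prod.snd).card := by
    rw [← Set.ncard_coe_finset]; simp
  have h3 := Finset.card_eq_sum_card_image Prod.snd hfin.toFinset
  rw [Finset.sum_const_nat (m := q)] at h3
  · rw [h2]
    rw [h1] at h3
    have : 0 < q := by omega
    apply Nat.eq_of_mul_eq_mul_right this
    rw [← h3]; ring
  · intro z hz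
    simp only [Finset.mem_image, Set.Finite.mem_toFinset, Prod.exists, exists_eq_right] at hz
    obtain ⟨y, hy⟩ := hz
    rw [← hS.fibre y z hy, ← Set.ncard_coe_finset]
    have : ((Finset.filter (fun p => p.2 = z) hfin.toFinset : Finset (C × C)) : Set (C × C)) =
        (fun y' => (y', z)) '' {y' | (y', z) ∈ S} := by
      ext ⟨u, v⟩
      simp only [Finset.coe_filter, Set.Finite.mem_toFinset, Set.mem_ofPred_eq, Set.mem_image,
        Prod.mk.injEq]
      constructor
      · rintro ⟨h, rfl⟩; exact ⟨u, h, rfl, rfl⟩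
      · rintro ⟨_, h, rfl, rfl⟩; exact ⟨h, rfl⟩
    rw [this, Set.ncard_image_of_injective _ (fun a b h => (Prod.mk.inj h).1)]

theorem slope_unique (hσ : IsQuadConj R σ) (hε : ε ∉ R)
    (hS : IsAffineSubunital R σ ε q S) {y y' z x x' a a' : C}
    (h : (y, z) ∈ S) (h' : (y', z) ∈ S) (hxz : x ≠ z) (hxz' : x' ≠ z) (hxx : x ≠ x')
    (h1 : (y + a * (x - z), x) ∈ S) (h2 : (y' + a' * (x - z), x) ∈ S)
    (h3 : (y + a * (x' - z), x') ∈ S) (h4 : (y' + a' * (x' - z), x') ∈ S) : a = a' := by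
  by_contra haa
  obtain ⟨r0, hr0, e0⟩ := hS.herm _ _ h
  obtain ⟨r0', hr0', e0'⟩ := hS.herm _ _ h'
  obtain ⟨r1, hr1, e1⟩ := hS.herm _ _ h1
  obtain ⟨r2, hr2, e2⟩ := hS.herm _ _ h2
  obtain ⟨r3, hr3, e3⟩ := hS.herm _ _ h3
  obtain ⟨r4, hr4, e4⟩ := hS.herm _ _ h4
  have hε0 : ε ≠ 0 := fun h => hε (h ▸ R.zero_mem)
  have haa' : a - a' ≠ 0 := sub_ne_zero.mpr haa
  have hw : x - z ≠ 0 := sub_ne_zero.mpr hxz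
  have hw' : x' - z ≠ 0 := sub_ne_zero.mpr hxz'
  have f1 : (a - a') * (x - z) = ε * (r1 - r2 - r0 + r0') := by
    linear_combination e1 - e2 - e0 + e0'
  have f2 : (a - a') * (x' - z) = ε * (r3 - r4 - r0 + r0') := by
    linear_combination e3 - e4 - e0 + e0'
  set s := r1 - r2 - r0 + r0'
  set s' := r3 - r4 - r0 + r0'
  have hs : s ∈ R := R.add_mem (R.sub_mem (R.sub_mem hr1 hr2) hr0) hr0'
  have hs' : s' ∈ R := R.add_mem (R.sub_mem (R.sub_mem hr3 hr4) hr0) hr0'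
  have hs0 : s ≠ 0 := by
    rintro hs
    rw [hs, mul_zero] at f1
    exact (mul_ne_zero haa' hw) f1
  obtain ⟨l, hl, hlw⟩ : ∃ l ∈ R, x' - z = l * (x - z) := by
    refine ⟨s' / s, R.div_mem hs' hs, ?_⟩
    apply mul_left_cancel₀ haa'
    rw [f2]
    field_simp
    linear_combination (-s') * f1
  have hx : x = z + (x - z) := by ring
  have hx' : x' = z + l * (x - z) := by rw [← hlw]; ring
  set w := x - z
  have hl0 : l ≠ 0 := by
    rintro rfl; apply hw'; rw [hlw]; ring
  have hl1 : l - 1 ≠ 0 := by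
    intro h
    have : l = 1 := sub_eq_zero.mp h
    apply hxx
    rw [hx, hx', this, one_mul]
  rw [hlw] at e3
  rw [hx, map_add] at e1
  rw [hx', map_add, map_mul, hσ.fix l hl] at e3
  have key : (l * (l - 1)) * (σ w * w) = ε * (r3 - r0 - l * (r1 - r0)) := by
    linear_combination e3 - e0 - l * (e1 - e0)
  have hN : (l * (l - 1)) * (σ w * w) ∈ R :=
    R.mul_mem (R.mul_mem hl (R.sub_mem hl R.one_mem)) (hσ.norm_mem w)
  have hN0 : (l * (l - 1)) * (σ w * w) ≠ 0 :=
    mul_ne_zero (mul_ne_zero hl0 hl1) (mul_ne_zero ((map_ne_zero σ).mpr hw) hw)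
  have hm : r3 - r0 - l * (r1 - r0) ∈ R :=
    R.sub_mem (R.sub_mem hr3 hr0) (R.mul_mem hl (R.sub_mem hr1 hr0))
  apply hε
  have hm0 : r3 - r0 - l * (r1 - r0) ≠ 0 := by
    intro h; rw [h, mul_zero] at key; exact hN0 key
  rw [eq_div_of_mul_eq hm0 key.symm]
  exact R.div_mem hN hm

theorem shift_mem (hσ : IsQuadConj R σ) (hε : ε ∉ R) (hq : 2 ≤ q)
    (hS : IsAffineSubunital R σ ε q S) {y y' z y₁ x : C}
    (h : (y, z) ∈ S) (h' : (y', z) ∈ S) (hxz : x ≠ z) (hx : (y₁, x) ∈ S) :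
    (y₁ + (y - y'), x) ∈ S := by
  classical
  by_contra hcon
  have hw : x - z ≠ 0 := sub_ne_zero.mpr hxz
  have hfin := hS.finite hq
  have hAfin : (Prod.snd '' S).Finite := hfin.image _
  set B := hAfin.toFinset \ {z, x}
  have hzA : z ∈ hAfin.toFinset := by
    rw [Set.Finite.mem_toFinset]; exact ⟨_, h, rfl⟩
  have hxA : x ∈ hAfin.toFinset := by
    rw [Set.Finite.mem_toFinset]; exact ⟨_, hx, rfl⟩
  have hB : B.card = q ^ 2 - 2 := by
    rw [Finset.card_sdiff_of_subset (by
        intro c hc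
        simp only [Finset.mem_insert, Finset.mem_singleton] at hc
        rcases hc with rfl | rfl <;> assumption),
      Finset.card_pair hxz.symm, ← Set.ncard_eq_toFinset_card _ hAfin, hS.ncard_image_snd hq]
  let K : C → C → Finset C := fun y₀ a => B.filter (fun c => (y₀ + a * (c - z), c) ∈ S)
  have hK : ∀ y₀ a, (y₀, z) ∈ S → (y₀ + a * (x - z), x) ∈ S → (K y₀ a).card = q - 1 := by
    intro y₀ a h0 h1
    have hb := hS.block a y₀ z h0 x hxz h1
    have : {c | (y₀ + a * (c - z), c) ∈ S} = insert z (insert x (K y₀ a : Set C)) := by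
      ext c
      simp only [Set.mem_ofPred_eq, Set.mem_insert_iff, K, B, Finset.coe_filter, Finset.mem_sdiff,
        Set.Finite.mem_toFinset, Finset.mem_insert, Finset.mem_singleton]
      constructor
      · intro hc
        by_cases hcz : c = z
        · exact Or.inl hcz
        by_cases hcx : c = x
        · exact Or.inr (Or.inl hcx)
        exact Or.inr (Or.inr ⟨⟨⟨_, hc, rfl⟩, by tauto⟩, hc⟩)
      · rintro (rfl | rfl | hc)
        · simpa using h0
        · exact h1
        · exact hc.2
    rw [this, Set.ncard_insert_of_notMem, Set.ncard_insert_of_notMem, Set.ncard_coe_finset] at hb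
    · omega
    · simp [K, B]
    · simp [K, B, hxz.symm]
  have hYfin : {c | (c, x) ∈ S}.Finite := by
    apply Set.finite_of_ncard_ne_zero
    rw [hS.fibre _ _ hx]; omega
  set Y := hYfin.toFinset
  have hY : Y.card = q := by
    rw [← Set.ncard_eq_toFinset_card _ hYfin, hS.fibre _ _ hx]
  have hslope : ∀ y₀ c : C, y₀ + (c - y₀) / (x - z) * (x - z) = c := by
    intro y₀ c; field_simp; ring
  have hdisj : ∀ y₀ a y₀' a', (y₀, z) ∈ S → (y₀', z) ∈ S → (y₀ + a * (x - z), x) ∈ S →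
      (y₀' + a' * (x - z), x) ∈ S → a ≠ a' → Disjoint (K y₀ a) (K y₀' a') := by
    intro y₀ a y₀' a' h0 h0' h1 h1' haa
    rw [Finset.disjoint_left]
    intro c hc hc'
    simp only [K, B, Finset.mem_filter, Finset.mem_sdiff, Finset.mem_insert,
      Finset.mem_singleton, not_or] at hc hc'
    exact haa (hS.slope_unique hσ hε h0 h0' hxz hc.1.2.1 (Ne.symm hc.1.2.2) h1 h1' hc.2 hc'.2)
  let V := Y.biUnion (fun c => K y ((c - y) / (x - z)))
  have hV : V.card = q * (q - 1) := by
    rw [Finset.card_biUnion, Finset.sum_const_nat (m := q - 1), hY]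
    · intro c hc
      apply hK _ _ h
      rw [hslope]
      simpa [Y] using hc
    · intro c hc c' hc' hcc
      apply hdisj _ _ _ _ h h
      · rw [hslope]; simpa [Y] using hc
      · rw [hslope]; simpa [Y] using hc'
      · intro heq
        apply hcc
        rw [div_left_inj' hw] at heq
        linear_combination heq
  have hx' : (y' + (y₁ - y') / (x - z) * (x - z), x) ∈ S := by rwa [hslope]
  have hVK : Disjoint V (K y' ((y₁ - y') / (x - z))) := by
    rw [Finset.disjoint_biUnion_left]
    intro c hc
    apply hdisj _ _ _ _ h h' _ hx'
    · intro heq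
      rw [div_left_inj' hw] at heq
      apply hcon
      have : c = y₁ + (y - y') := by linear_combination heq
      rw [← this]
      simpa [Y] using hc
    · rw [hslope]; simpa [Y] using hc
  have hsub : V ∪ K y' ((y₁ - y') / (x - z)) ⊆ B := by
    apply Finset.union_subset
    · exact Finset.biUnion_subset.mpr fun _ _ => Finset.filter_subset _ _
    · exact Finset.filter_subset _ _
  have hle := Finset.card_le_card hsub
  rw [Finset.card_union_of_disjoint hVK, hV, hK _ _ h' hx', hB] at hle
  obtain ⟨m, rfl⟩ : ∃ m, q = m + 2 := ⟨q - 2, by omega⟩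
  have e1 : m + 2 - 1 = m + 1 := rfl
  have e2 : (m + 2) ^ 2 - 2 = m ^ 2 + 4 * m + 2 := by
    have : (m + 2) ^ 2 = m ^ 2 + 4 * m + 4 := by ring
    omega
  rw [e1, e2] at hle
  nlinarith

/-- The translations with centre `[0,1,0]` leaving a subunital invariant act transitively on the
affine part of each of its blocks through `[0,1,0]`. -/
theorem exists_translations (hσ : IsQuadConj R σ) (hε : ε ∉ R) (hq : 2 ≤ q)
    (hS : IsAffineSubunital R σ ε q S) :
    ∃ T : AddSubgroup C, (∀ s ∈ T, s ∈ R) ∧ (T : Set C).ncard = q ∧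
      ∀ y z, (y, z) ∈ S → ∀ y', (y', z) ∈ S ↔ ∃ s ∈ T, y' = y + ε * s := by
  have hε0 : ε ≠ 0 := fun h => hε (h ▸ R.zero_mem)
  have hall : ∀ y z y', (y, z) ∈ S → (y', z) ∈ S → ∀ y₁ x, (y₁, x) ∈ S →
      (y₁ + (y' - y), x) ∈ S := by
    intro y z y' h h' y₁ x hx
    rcases eq_or_ne x z with rfl | hxz
    · obtain ⟨⟨y₂, x₂⟩, h₂, hne⟩ : ∃ p ∈ S, p.2 ≠ x := by
        by_contra! hcon
        have : Prod.snd '' S ⊆ {x} := by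
          rintro _ ⟨p, hp, rfl⟩; exact hcon p hp
        have := Set.ncard_le_ncard this
        rw [hS.ncard_image_snd hq, Set.ncard_singleton] at this
        nlinarith
      have h₃ := hS.shift_mem hσ hε hq h' h hne h₂
      have := hS.shift_mem hσ hε hq h₃ h₂ hne.symm hx
      simpa using this
    · exact hS.shift_mem hσ hε hq h' h hxz hx
  let T : AddSubgroup C :=
    { carrier := {s | ∀ y z, (y, z) ∈ S → (y + ε * s, z) ∈ S ∧ (y - ε * s, z) ∈ S}
      zero_mem' := by intro y z h; simpa using h
      add_mem' := by
        intro s s' hs hs' y z h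
        constructor
        · have := (hs' _ _ (hs y z h).1).1
          convert this using 2; ring
        · have := (hs' _ _ (hs y z h).2).2
          convert this using 2; ring
      neg_mem' := by
        intro s hs y z h
        have := hs y z h
        simpa [← sub_eq_add_neg] using this.symm }
  have hfib : ∀ y z, (y, z) ∈ S → ∀ y', (y', z) ∈ S ↔ ∃ s ∈ T, y' = y + ε * s := by
    intro y z h y'
    constructor
    · intro h'
      refine ⟨(y' - y) / ε, ?_, by field_simp; ring⟩
      intro y₁ x hx
      have e : ε * ((y' - y) / ε) = y' - y := by field_simp
      rw [e]
      refine ⟨hall _ _ _ h h' _ _ hx, ?_⟩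
      have := hall _ _ _ h' h _ _ hx
      convert this using 2; ring
    · rintro ⟨s, hs, rfl⟩
      exact (hs y z h).1
  obtain ⟨⟨y, z⟩, h⟩ : S.Nonempty := by
    apply Set.nonempty_of_ncard_ne_zero
    rw [hS.card]; positivity
  refine ⟨T, ?_, ?_, hfib⟩
  · intro s hs
    obtain ⟨r, hr, e⟩ := hS.herm _ _ h
    obtain ⟨r', hr', e'⟩ := hS.herm _ _ ((hfib y z h _).mpr ⟨s, hs, rfl⟩)
    have : s = r' - r := by
      apply mul_left_cancel₀ hε0
      linear_combination e' - e
    rw [this]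
    exact R.sub_mem hr' hr
  · rw [← hS.fibre y z h]
    have : {y' | (y', z) ∈ S} = (fun s => y + ε * s) '' (T : Set C) := by
      ext y'
      rw [Set.mem_ofPred_eq, hfib y z h]
      simp [eq_comm]
    rw [this, Set.ncard_image_of_injective]
    intro s s' hss
    exact mul_left_cancel₀ hε0 (add_left_cancel hss)

end IsAffineSubunital

theorem IsQuadConj.mem_iff {C : Type*} [Field C] {R : Subfield C} {σ : C →+* C}
    (hσ : IsQuadConj R σ) (z : C) : σ z ∈ R ↔ z ∈ R := by
  refine ⟨fun h => ?_, fun h => by rwa [hσ.fix z h]⟩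
  rw [← hσ.invol z, hσ.fix _ h]
  exact h

theorem apply_rep_eq_zero_iff {C : Type*} [Field C] (f : (Fin 3 → C) →ₗ[C] C) {v : Fin 3 → C}
    (hv : v ≠ 0) : f (Projectivization.mk C v hv).rep = 0 ↔ f v = 0 := by
  obtain ⟨a, ha⟩ := Projectivization.exists_smul_eq_mk_rep C v hv
  rw [← ha, Units.smul_def, map_smul, smul_eq_mul, mul_eq_zero]
  simp

theorem one_cons_ne_zero {C : Type*} [Field C] (y z : C) : (![1, y, z] : Fin 3 → C) ≠ 0 :=
  fun h => one_ne_zero (congrFun h 0)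

theorem vec_zero_one_zero_ne_zero {C : Type*} [Field C] : (![0, 1, 0] : Fin 3 → C) ≠ 0 :=
  fun h => one_ne_zero (congrFun h 1)

/-- A reformulation of `IsSubunital` in terms of linear forms. -/
structure IsLinSubunital {C : Type*} [Field C] (R : Subfield C) (σ : C →+* C) (ε : C)
    (q : ℕ) (U : Set (Projectivization C (Fin 3 → C))) : Prop where
  herm : ∀ v hv, Projectivization.mk C v hv ∈ U → ∃ r ∈ R, σ (v 0) * v 1 + σ (v 2) * v 2 = ε * r
  card : U.ncard = q ^ 3 + 1
  line : ∀ f : (Fin 3 → C) →ₗ[C] C, f ≠ 0 → ({P | f P.rep = 0} ∩ U).Nontrivial →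
    ({P | f P.rep = 0} ∩ U).ncard = q + 1

theorem IsSubunital.isLinSubunital {C : Type*} [Field C] {R : Subfield C} {σ : C →+* C} {ε : C}
    (hσ : IsQuadConj R σ) {q : ℕ} {U : Set (Projectivization C (Fin 3 → C))}
    (hU : IsSubunital R σ ε q U) : IsLinSubunital R σ ε q U := by
  obtain ⟨hsub, hcard, hline⟩ := hU
  refine ⟨?_, hcard, ?_⟩
  · intro v hv hvU
    obtain ⟨w, hw, hvw, r, hr, e⟩ := hsub hvU
    obtain ⟨a, ha⟩ := (Projectivization.mk_eq_mk_iff C v w hv hw).mp hvw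
    refine ⟨σ a * a * r, R.mul_mem (hσ.norm_mem _) hr, ?_⟩
    rw [← ha]
    simp only [Units.smul_def, Pi.smul_apply, smul_eq_mul, map_mul]
    linear_combination (σ a * a) * e
  · intro f hf hnt
    have h1 : {P : Projectivization C (Fin 3 → C) | f P.rep = 0} ∩ U =
        (hermSet R σ ε ∩ {P | f P.rep = 0}) ∩ U := by
      ext P
      constructor
      · rintro ⟨h1, h2⟩; exact ⟨⟨hsub h2, h1⟩, h2⟩
      · rintro ⟨⟨_, h1⟩, h2⟩; exact ⟨h1, h2⟩
    rw [h1] at hnt ⊢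
    exact hline _ ⟨_, ⟨f, hf, rfl⟩, hnt.mono Set.inter_subset_left, rfl⟩ hnt

namespace IsLinSubunital

variable {C : Type*} [Field C] {R : Subfield C} {σ : C →+* C} {ε : C} {q : ℕ}
  {U : Set (Projectivization C (Fin 3 → C))}

theorem map (hU : IsLinSubunital R σ ε q U) (e : (Fin 3 → C) ≃ₗ[C] (Fin 3 → C)) {ε' : C}
    (he : ∀ v, (∃ r ∈ R, σ (v 0) * v 1 + σ (v 2) * v 2 = ε * r) →
      ∃ r ∈ R, σ (e v 0) * e v 1 + σ (e v 2) * e v 2 = ε' * r) :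
    IsLinSubunital R σ ε' q (Projectivization.map e.toLinearMap e.injective '' U) := by
  have hinj := Projectivization.map_injective e.toLinearMap e.injective
  refine ⟨?_, ?_, ?_⟩
  · rintro v hv ⟨P, hP, hPv⟩
    induction P using Projectivization.ind with
    | h w hw =>
      rw [Projectivization.map_mk, Projectivization.mk_eq_mk_iff] at hPv
      obtain ⟨a, ha⟩ := hPv
      have hv' : v = e ((a⁻¹ : Cˣ) • w) := by
        rw [Units.smul_def, map_smul, ← Units.smul_def, eq_inv_smul_iff]
        exact ha
      rw [hv']
      apply he
      have hw' : (a⁻¹ : Cˣ) • w ≠ 0 := by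
        rw [Units.smul_def]; exact smul_ne_zero (Units.ne_zero _) hw
      apply hU.herm _ hw'
      rwa [(Projectivization.mk_eq_mk_iff C _ w hw' hw).mpr ⟨a⁻¹, rfl⟩]
  · rw [Set.ncard_image_of_injective _ hinj, hU.card]
  · intro f hf hnt
    have key : {P | f P.rep = 0} ∩ (Projectivization.map e.toLinearMap e.injective '' U) =
        Projectivization.map e.toLinearMap e.injective ''
          ({P | (f ∘ₗ e.toLinearMap) P.rep = 0} ∩ U) := by
      have : ∀ P : Projectivization C (Fin 3 → C),
          f (Projectivization.map e.toLinearMap e.injective P).rep = 0 ↔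
          (f ∘ₗ e.toLinearMap) P.rep = 0 := by
        intro P
        induction P using Projectivization.ind with
        | h w hw =>
          rw [Projectivization.map_mk, apply_rep_eq_zero_iff, apply_rep_eq_zero_iff]
          rfl
      ext P
      constructor
      · rintro ⟨h1, Q, hQ, rfl⟩
        exact ⟨Q, ⟨(this Q).mp h1, hQ⟩, rfl⟩
      · rintro ⟨Q, ⟨h1, hQ⟩, rfl⟩
        exact ⟨(this Q).mpr h1, Q, hQ, rfl⟩
    rw [key] at hnt ⊢
    rw [Set.ncard_image_of_injective _ hinj]
    apply hU.line
    · intro h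
      apply hf
      ext1 v
      have := LinearMap.congr_fun h (e.symm (Pi.single v 1))
      ext
      simpa using this
    · exact Set.nontrivial_of_image _ _ hnt

end IsLinSubunital

/-- The affine coordinates of the points `[1, y, z]` in a set of points of `PG(2,C)`. -/
def affinePart {C : Type*} [Field C] (U : Set (Projectivization C (Fin 3 → C))) : Set (C × C) :=
  {p | Projectivization.mk C ![1, p.1, p.2] (one_cons_ne_zero p.1 p.2) ∈ U}

/-- The linear form with given coefficients. -/
def linForm {C : Type*} [Field C] (a b c : C) : (Fin 3 → C) →ₗ[C] C :=
  a • LinearMap.proj 0 + b • LinearMap.proj 1 + c • LinearMap.proj 2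

theorem linForm_apply {C : Type*} [Field C] (a b c : C) (v : Fin 3 → C) :
    linForm a b c v = a * v 0 + b * v 1 + c * v 2 := rfl

namespace IsLinSubunital

variable {C : Type*} [Field C] {R : Subfield C} {σ : C →+* C} {ε : C} {q : ℕ}
  {U : Set (Projectivization C (Fin 3 → C))}

theorem eq_infty_or_affine (hσ : IsQuadConj R σ) (hε : ε ∉ R) (hU : IsLinSubunital R σ ε q U)
    {P : Projectivization C (Fin 3 → C)} (hP : P ∈ U) :
    P = Projectivization.mk C ![0, 1, 0] vec_zero_one_zero_ne_zero ∨
    ∃ y z, P = Projectivization.mk C ![1, y, z] (one_cons_ne_zero y z) := by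
  induction P using Projectivization.ind with
  | h v hv =>
    by_cases h0 : v 0 = 0
    · left
      obtain ⟨r, hr, e⟩ := hU.herm v hv hP
      rw [h0, map_zero, zero_mul, zero_add] at e
      have h2 : v 2 = 0 := by
        by_contra h2
        have hN0 : σ (v 2) * v 2 ≠ 0 := mul_ne_zero ((map_ne_zero σ).mpr h2) h2
        have hr0 : r ≠ 0 := by
          rintro rfl; rw [mul_zero] at e; exact hN0 e
        apply hε
        rw [eq_div_of_mul_eq hr0 e.symm]
        exact R.div_mem (hσ.norm_mem _) hr
      rw [Projectivization.mk_eq_mk_iff']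
      refine ⟨v 1, ?_⟩
      ext i
      fin_cases i <;> simp [h0, h2]
    · right
      refine ⟨v 1 / v 0, v 2 / v 0, ?_⟩
      rw [Projectivization.mk_eq_mk_iff']
      refine ⟨v 0, ?_⟩
      ext i
      fin_cases i
      · simp
      · simp; field_simp
      · simp; field_simp

theorem mk_affine_injective :
    Function.Injective (fun p : C × C =>
      Projectivization.mk C ![1, p.1, p.2] (one_cons_ne_zero p.1 p.2)) := by
  rintro ⟨y, z⟩ ⟨y', z'⟩ h
  simp only [Projectivization.mk_eq_mk_iff'] at h
  obtain ⟨a, ha⟩ := h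
  have h0 := congrFun ha 0
  have h1 := congrFun ha 1
  have h2 := congrFun ha 2
  simp at h0 h1 h2
  subst h0
  simp at h1 h2
  rw [h1, h2]

theorem mk_infty_ne_affine (y z : C) :
    Projectivization.mk C ![0, 1, 0] vec_zero_one_zero_ne_zero ≠
      Projectivization.mk C ![1, y, z] (one_cons_ne_zero y z) := by
  rw [Ne, Projectivization.mk_eq_mk_iff']
  rintro ⟨a, ha⟩
  have h0 := congrFun ha 0
  have h1 := congrFun ha 1
  simp at h0 h1
  simp [h0] at h1

theorem eq_insert_image (hσ : IsQuadConj R σ) (hε : ε ∉ R) (hU : IsLinSubunital R σ ε q U)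
    (hinf : Projectivization.mk C ![0, 1, 0] vec_zero_one_zero_ne_zero ∈ U) :
    U = insert (Projectivization.mk C ![0, 1, 0] vec_zero_one_zero_ne_zero)
      ((fun p : C × C => Projectivization.mk C ![1, p.1, p.2] (one_cons_ne_zero p.1 p.2)) ''
        affinePart U) := by
  ext P
  constructor
  · intro hP
    rcases hU.eq_infty_or_affine hσ hε hP with rfl | ⟨y, z, rfl⟩
    · exact Or.inl rfl
    · exact Or.inr ⟨(y, z), hP, rfl⟩
  · rintro (rfl | ⟨p, hp, rfl⟩)
    · exact hinf
    · exact hp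

theorem isAffineSubunital (hσ : IsQuadConj R σ) (hε : ε ∉ R) (hq : 2 ≤ q)
    (hU : IsLinSubunital R σ ε q U)
    (hinf : Projectivization.mk C ![0, 1, 0] vec_zero_one_zero_ne_zero ∈ U) :
    IsAffineSubunital R σ ε q (affinePart U) := by
  have heq := hU.eq_insert_image hσ hε hinf
  have hUfin : U.Finite := Set.finite_of_ncard_ne_zero (by rw [hU.card]; positivity)
  have hinj := mk_affine_injective (C := C)
  have hnot : ∀ S : Set (C × C), Projectivization.mk C ![0, 1, 0] vec_zero_one_zero_ne_zero ∉
      ((fun p : C × C => Projectivization.mk C ![1, p.1, p.2] (one_cons_ne_zero p.1 p.2)) ''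
        S) := by
    rintro S ⟨p, _, hp⟩
    exact mk_infty_ne_affine _ _ hp.symm
  have hafin : (affinePart U).Finite := by
    apply Set.Finite.of_finite_image _ hinj.injOn
    apply hUfin.subset
    rintro _ ⟨p, hp, rfl⟩; exact hp
  refine ⟨?_, ?_, ?_, ?_⟩
  · intro y z h
    obtain ⟨r, hr, e⟩ := hU.herm _ _ h
    exact ⟨r, hr, by simpa using e⟩
  · have := hU.card
    rw [heq, Set.ncard_insert_of_notMem (hnot _) (hafin.image _),
      Set.ncard_image_of_injective _ hinj] at this
    omega
  · intro y z h
    have hset : {P | linForm (-z) 0 1 P.rep = 0} ∩ U =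
        insert (Projectivization.mk C ![0, 1, 0] vec_zero_one_zero_ne_zero)
          ((fun p : C × C => Projectivization.mk C ![1, p.1, p.2] (one_cons_ne_zero p.1 p.2)) ''
            ((fun y' => (y', z)) '' {y' | (y', z) ∈ affinePart U})) := by
      ext P
      constructor
      · rintro ⟨h1, h2⟩
        rcases hU.eq_infty_or_affine hσ hε h2 with rfl | ⟨y', z', rfl⟩
        · exact Or.inl rfl
        · rw [Set.mem_ofPred_eq, apply_rep_eq_zero_iff, linForm_apply] at h1
          simp at h1
          have : z' = z := by linear_combination h1
          subst this
          exact Or.inr ⟨_, ⟨y', h2, rfl⟩, rfl⟩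
      · rintro (rfl | ⟨_, ⟨y', h2, rfl⟩, rfl⟩)
        · refine ⟨?_, hinf⟩
          rw [Set.mem_ofPred_eq, apply_rep_eq_zero_iff, linForm_apply]
          simp
        · refine ⟨?_, h2⟩
          rw [Set.mem_ofPred_eq, apply_rep_eq_zero_iff, linForm_apply]
          simp
    have hc := hU.line (linForm (-z) 0 1) (by
      intro h
      have := LinearMap.congr_fun h ![0, 0, 1]
      rw [linForm_apply] at this
      simp at this) (by
      rw [hset]
      exact ⟨_, Or.inl rfl, _, Or.inr ⟨_, ⟨y, h, rfl⟩, rfl⟩, mk_infty_ne_affine _ _⟩)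
    have hinj2 : Function.Injective (fun y' : C => (y', z)) := fun a b h => (Prod.mk.inj h).1
    have hfin2 : ((fun y' => (y', z)) '' {y' | (y', z) ∈ affinePart U}).Finite := by
      apply hafin.subset
      rintro _ ⟨_, h, rfl⟩; exact h
    rw [hset, Set.ncard_insert_of_notMem (hnot _) (hfin2.image _),
      Set.ncard_image_of_injective _ hinj, Set.ncard_image_of_injective _ hinj2] at hc
    omega
  · intro a y z h z' hz' h'
    have hset : {P | linForm (a * z - y) 1 (-a) P.rep = 0} ∩ U =
          ((fun p : C × C => Projectivization.mk C ![1, p.1, p.2] (one_cons_ne_zero p.1 p.2)) ''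
            ((fun x => (y + a * (x - z), x)) '' {x | (y + a * (x - z), x) ∈ affinePart U})) := by
      ext P
      constructor
      · rintro ⟨h1, h2⟩
        rcases hU.eq_infty_or_affine hσ hε h2 with rfl | ⟨y', z', rfl⟩
        · rw [Set.mem_ofPred_eq, apply_rep_eq_zero_iff, linForm_apply] at h1
          simp at h1
        · rw [Set.mem_ofPred_eq, apply_rep_eq_zero_iff, linForm_apply] at h1
          simp at h1
          have : y' = y + a * (z' - z) := by linear_combination h1
          subst this
          exact ⟨_, ⟨z', h2, rfl⟩, rfl⟩
      · rintro ⟨_, ⟨x, h2, rfl⟩, rfl⟩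
        refine ⟨?_, h2⟩
        rw [Set.mem_ofPred_eq, apply_rep_eq_zero_iff, linForm_apply]
        simp
        ring
    have hinj2 : Function.Injective (fun x : C => (y + a * (x - z), x)) :=
      fun a b h => (Prod.mk.inj h).2
    have hc := hU.line (linForm (a * z - y) 1 (-a)) (by
      intro h
      have := LinearMap.congr_fun h ![0, 1, 0]
      rw [linForm_apply] at this
      simp at this) (by
      rw [hset]
      apply Set.Nontrivial.image _ hinj
      apply Set.Nontrivial.image _ hinj2
      refine ⟨z, by simpa using h, z', h', hz'.symm⟩)
    rwa [hset, Set.ncard_image_of_injective _ hinj, Set.ncard_image_of_injective _ hinj2] at hc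

end IsLinSubunital

/-- The linear map `(X, Y, Z) ↦ (X, Y + βZ + γX, Z + δX)`. -/
def shearEquiv {C : Type*} [Field C] (β γ δ : C) : (Fin 3 → C) ≃ₗ[C] (Fin 3 → C) where
  toFun v := ![v 0, v 1 + β * v 2 + γ * v 0, v 2 + δ * v 0]
  invFun v := ![v 0, v 1 - γ * v 0 - β * (v 2 - δ * v 0), v 2 - δ * v 0]
  map_add' v w := by ext i; fin_cases i <;> simp <;> ring
  map_smul' a v := by ext i; fin_cases i <;> simp <;> ring
  left_inv v := by ext i; fin_cases i <;> simp
  right_inv v := by ext i; fin_cases i <;> simp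

/-- The linear map `(X, Y, Z) ↦ (Y, X, Z)`. -/
def swapEquiv {C : Type*} [Field C] : (Fin 3 → C) ≃ₗ[C] (Fin 3 → C) where
  toFun v := ![v 1, v 0, v 2]
  invFun v := ![v 1, v 0, v 2]
  map_add' v w := by ext i; fin_cases i <;> simp
  map_smul' a v := by ext i; fin_cases i <;> simp
  left_inv v := by ext i; fin_cases i <;> simp
  right_inv v := by ext i; fin_cases i <;> simp

theorem mk_mem_map_image_iff {C : Type*} [Field C] (e : (Fin 3 → C) ≃ₗ[C] (Fin 3 → C))
    (U : Set (Projectivization C (Fin 3 → C))) {v w : Fin 3 → C} (hv : v ≠ 0) (hw : w ≠ 0)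
    (a : C) (h : a • e w = v) :
    Projectivization.mk C v hv ∈ Projectivization.map e.toLinearMap e.injective '' U ↔
      Projectivization.mk C w hw ∈ U := by
  have : Projectivization.mk C v hv =
      Projectivization.map e.toLinearMap e.injective (Projectivization.mk C w hw) := by
    rw [Projectivization.map_mk, Projectivization.mk_eq_mk_iff']
    exact ⟨a, h⟩
  rw [this, (Projectivization.map_injective e.toLinearMap e.injective).mem_set_image]

namespace IsLinSubunital

variable {C : Type*} [Field C] {R : Subfield C} {σ : C →+* C} {ε : C} {q : ℕ}
  {U : Set (Projectivization C (Fin 3 → C))}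

theorem exists_shear (hσ : IsQuadConj R σ) (hε : ε ∉ R) (hU : IsLinSubunital R σ ε q U)
    {y₀ z₀ : C} (h0 : (y₀, z₀) ∈ affinePart U) :
    ∃ e : (Fin 3 → C) ≃ₗ[C] (Fin 3 → C),
      IsLinSubunital R σ ε q (Projectivization.map e.toLinearMap e.injective '' U) ∧
      (Projectivization.mk C ![0, 1, 0] vec_zero_one_zero_ne_zero ∈
          Projectivization.map e.toLinearMap e.injective '' U ↔
        Projectivization.mk C ![0, 1, 0] vec_zero_one_zero_ne_zero ∈ U) ∧
      ∃ β, ∀ y z, (y - y₀ + β * (z - z₀), z - z₀) ∈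
        affinePart (Projectivization.map e.toLinearMap e.injective '' U) ↔
          (y, z) ∈ affinePart U := by
  have hε0 : ε ≠ 0 := fun h => hε (h ▸ R.zero_mem)
  have hσε : σ ε ≠ 0 := (map_ne_zero σ).mpr hε0
  obtain ⟨r₀, hr₀, e₀⟩ := hU.herm _ _ h0
  simp only [Matrix.cons_val_zero, Matrix.cons_val_one, Matrix.cons_val, map_one, one_mul] at e₀
  set β := -σ z₀ * (ε - σ ε) / σ ε with hβ
  refine ⟨shearEquiv β (-y₀ - β * z₀) (-z₀), hU.map _ ?_, ?_, β, ?_⟩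
  · rintro v ⟨r, hr, e⟩
    refine ⟨r + σ (v 0) * v 0 * (-r₀ + σ z₀ * z₀ * ((ε + σ ε) / (σ ε * ε))) -
        ((σ (v 2) * z₀ * v 0 / ε) + σ (σ (v 2) * z₀ * v 0 / ε)), ?_, ?_⟩
    · refine R.sub_mem (R.add_mem hr (R.mul_mem (hσ.norm_mem _) (R.add_mem (R.neg_mem hr₀)
        (R.mul_mem (hσ.norm_mem _) (R.div_mem (hσ.trace_mem _) (hσ.norm_mem _)))))) ?_
      exact hσ.trace_mem _
    · simp only [shearEquiv, LinearEquiv.coe_mk, LinearMap.coe_mk, AddHom.coe_mk,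
        Matrix.cons_val_zero, Matrix.cons_val_one, Matrix.cons_val, map_add, map_mul, map_neg,
        map_div₀, hσ.invol]
      have hβ' : β * σ ε = -σ z₀ * (ε - σ ε) := by rw [hβ]; field_simp
      clear_value β
      have e1 : ε * (r + σ (v 0) * v 0 * (-r₀ + σ z₀ * z₀ * ((ε + σ ε) / (σ ε * ε))) -
          ((σ (v 2) * z₀ * v 0 / ε) + v 2 * σ z₀ * σ (v 0) / σ ε)) =
          ε * r + σ (v 0) * v 0 * (-(ε * r₀) + σ z₀ * z₀ * ((ε + σ ε) / σ ε)) -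
          (σ (v 2) * z₀ * v 0 + ε * (v 2 * σ z₀ * σ (v 0) / σ ε)) := by
        field_simp
      rw [e1, ← e, ← e₀]
      apply mul_right_cancel₀ hσε
      field_simp
      linear_combination (σ (v 0) * v 2 - σ (v 0) * v 0 * z₀) * hβ'
  · apply mk_mem_map_image_iff _ _ _ _ 1
    ext i; fin_cases i <;> simp [shearEquiv]
  · intro y z
    apply mk_mem_map_image_iff _ _ _ _ 1
    ext i; fin_cases i <;> simp [shearEquiv] <;> ring

theorem swap (hσ : IsQuadConj R σ) (hU : IsLinSubunital R σ ε q U) :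
    IsLinSubunital R σ (σ ε) q
      (Projectivization.map swapEquiv.toLinearMap swapEquiv.injective '' U) := by
  apply hU.map
  rintro v ⟨r, hr, e⟩
  refine ⟨r, hr, ?_⟩
  have := congrArg σ e
  simp only [map_add, map_mul, hσ.invol, hσ.fix r hr] at this
  simp only [swapEquiv, LinearEquiv.coe_mk, LinearMap.coe_mk, AddHom.coe_mk,
        Matrix.cons_val_zero, Matrix.cons_val_one, Matrix.cons_val]
  linear_combination this

theorem infty_mem_swap :
    Projectivization.mk C ![0, 1, 0] vec_zero_one_zero_ne_zero ∈
      Projectivization.map swapEquiv.toLinearMap swapEquiv.injective '' U ↔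
    (0, 0) ∈ affinePart U := by
  apply mk_mem_map_image_iff _ _ _ _ 1
  ext i; fin_cases i <;> simp [swapEquiv]

theorem zero_mem_swap :
    (0, 0) ∈ affinePart (Projectivization.map swapEquiv.toLinearMap swapEquiv.injective '' U) ↔
    Projectivization.mk C ![0, 1, 0] vec_zero_one_zero_ne_zero ∈ U := by
  apply mk_mem_map_image_iff _ _ _ _ 1
  ext i; fin_cases i <;> simp [swapEquiv]

theorem mem_swap {y z : C} (hy : y ≠ 0) :
    (y⁻¹, z / y) ∈
      affinePart (Projectivization.map swapEquiv.toLinearMap swapEquiv.injective '' U) ↔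
    (y, z) ∈ affinePart U := by
  apply mk_mem_map_image_iff _ _ _ _ y⁻¹
  ext i; fin_cases i <;> simp [swapEquiv, hy, div_eq_inv_mul]

/-- For a subunital containing `[0,1,0]` and `[1,0,0]`, the translations with centre `[0,1,0]`
determine those with centre `[1,0,0]`. -/
theorem opposite_translations (hσ : IsQuadConj R σ) (hε : ε ∉ R) (hq : 2 ≤ q)
    (hU : IsLinSubunital R σ ε q U)
    (hinf : Projectivization.mk C ![0, 1, 0] vec_zero_one_zero_ne_zero ∈ U)
    (h0 : (0, 0) ∈ affinePart U) {T : AddSubgroup C}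
    (hT : ∀ y z, (y, z) ∈ affinePart U → ∀ y', (y', z) ∈ affinePart U ↔ ∃ s ∈ T, y' = y + ε * s) :
    (∀ s ∈ T, ∀ s' ∈ T, s ≠ 0 → s' ≠ 0 → s + s' ≠ 0 → (s⁻¹ + s'⁻¹)⁻¹ ∈ T) ∧
    ∀ s ∈ T, s ≠ 0 → ∀ y z, (y, z) ∈ affinePart U → y ≠ 0 → y + ε * s ≠ 0 →
      ((y⁻¹ + (ε * s)⁻¹)⁻¹, z / y / (y⁻¹ + (ε * s)⁻¹)) ∈ affinePart U := by
  have hε0 : ε ≠ 0 := fun h => hε (h ▸ R.zero_mem)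
  have hσε : σ ε ∉ R := fun h => hε ((hσ.mem_iff ε).mp h)
  have hσε0 : σ ε ≠ 0 := (map_ne_zero σ).mpr hε0
  have hU' := hU.swap hσ
  have hS' := hU'.isAffineSubunital hσ hσε hq (infty_mem_swap.mpr h0)
  obtain ⟨T', -, -, hT'⟩ := hS'.exists_translations hσ hσε hq
  have h0' := (zero_mem_swap (U := U)).mpr hinf
  have hmem0 : ∀ y, (y, 0) ∈ affinePart U ↔ ∃ s ∈ T, y = ε * s := by
    intro y; rw [hT 0 0 h0]; simp
  have hmem0' : ∀ y : C, y ≠ 0 → ((∃ s ∈ T', y⁻¹ = σ ε * s) ↔ ∃ s ∈ T, y = ε * s) := by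
    intro y hy
    rw [← hmem0, ← mem_swap hy, zero_div, hT' 0 0 h0']
    simp
  have second : ∀ s ∈ T, s ≠ 0 → ∀ y z, (y, z) ∈ affinePart U → y ≠ 0 → y + ε * s ≠ 0 →
      ((y⁻¹ + (ε * s)⁻¹)⁻¹, z / y / (y⁻¹ + (ε * s)⁻¹)) ∈ affinePart U := by
    intro s hs hs0 y z hyz hy hne
    obtain ⟨s', hs', e⟩ := (hmem0' (ε * s) (mul_ne_zero hε0 hs0)).mpr ⟨s, hs, rfl⟩
    have hne' : y⁻¹ + (ε * s)⁻¹ ≠ 0 := by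
      have : y⁻¹ + (ε * s)⁻¹ = (y + ε * s) / (y * (ε * s)) := by field_simp; ring
      rw [this]
      exact div_ne_zero hne (mul_ne_zero hy (mul_ne_zero hε0 hs0))
    have h1 := (hT' _ _ ((mem_swap hy).mpr hyz) (y⁻¹ + (ε * s)⁻¹)).mpr ⟨s', hs', by rw [e]⟩
    rw [← mem_swap (inv_ne_zero hne')]
    convert h1 using 2
    · rw [inv_inv]
    · rw [div_inv_eq_mul, div_mul_cancel₀ _ hne']
  refine ⟨?_, second⟩
  intro s hs s' hs' hs0 hs0' hne
  have h1 := second s' hs' hs0' (ε * s) 0 ((hmem0 _).mpr ⟨s, hs, rfl⟩) (mul_ne_zero hε0 hs0)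
    (by rw [← mul_add]; exact mul_ne_zero hε0 hne)
  rw [zero_div, zero_div, hmem0] at h1
  obtain ⟨s'', hs'', e⟩ := h1
  have : (s⁻¹ + s'⁻¹)⁻¹ = s'' := by
    apply mul_left_cancel₀ hε0
    rw [← e, mul_inv, mul_inv, ← mul_add, mul_inv, inv_inv]
  rwa [this]

end IsLinSubunital

section SubfieldSpan

variable {C : Type*} [Field C] {F : Subfield C} {u : C}

theorem add_mul_eq_zero_iff (hu : u ∉ F) {α β : C} (hα : α ∈ F) (hβ : β ∈ F) :
    α + β * u = 0 ↔ α = 0 ∧ β = 0 := by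
  constructor
  · intro h
    have hβ0 : β = 0 := by
      by_contra hβ0
      apply hu
      have : u = -α / β := by field_simp; linear_combination h
      rw [this]
      exact F.div_mem (F.neg_mem hα) hβ
    subst hβ0
    exact ⟨by simpa using h, rfl⟩
  · rintro ⟨rfl, rfl⟩; simp

/-- The set `F + F u`. -/
def linSpan (F : Subfield C) (u : C) : Set C := {x | ∃ α ∈ F, ∃ β ∈ F, x = α + β * u}

theorem ncard_linSpan (hu : u ∉ F) :
    (linSpan F u).ncard = (F : Set C).ncard ^ 2 := by
  have : linSpan F u = (fun p : C × C => p.1 + p.2 * u) '' ((F : Set C) ×ˢ (F : Set C)) := by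
    ext x
    constructor
    · rintro ⟨α, hα, β, hβ, rfl⟩; exact ⟨(α, β), ⟨hα, hβ⟩, rfl⟩
    · rintro ⟨p, ⟨hα, hβ⟩, rfl⟩; exact ⟨p.1, hα, p.2, hβ, rfl⟩
  rw [this, Set.InjOn.ncard_image, Set.ncard_prod, sq]
  rintro ⟨α, β⟩ ⟨hα, hβ⟩ ⟨α', β'⟩ ⟨hα', hβ'⟩ h
  have := (add_mul_eq_zero_iff hu (F.sub_mem hα hα') (F.sub_mem hβ hβ')).mp
    (by simp only at h; linear_combination h)
  exact Prod.ext (sub_eq_zero.mp this.1) (sub_eq_zero.mp this.2)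

/-- For `u` quadratic over `F`, the set `F + F u` is a field. -/
def quadSubfield (hu : u ∉ F) {a b : C} (ha : a ∈ F) (hb : b ∈ F) (hq : u * u = a * u + b) :
    Subfield C where
  carrier := linSpan F u
  zero_mem' := ⟨0, F.zero_mem, 0, F.zero_mem, by simp⟩
  one_mem' := ⟨1, F.one_mem, 0, F.zero_mem, by simp⟩
  add_mem' := by
    rintro _ _ ⟨α, hα, β, hβ, rfl⟩ ⟨α', hα', β', hβ', rfl⟩
    exact ⟨α + α', F.add_mem hα hα', β + β', F.add_mem hβ hβ', by ring⟩
  neg_mem' := by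
    rintro _ ⟨α, hα, β, hβ, rfl⟩
    exact ⟨-α, F.neg_mem hα, -β, F.neg_mem hβ, by ring⟩
  mul_mem' := by
    rintro _ _ ⟨α, hα, β, hβ, rfl⟩ ⟨α', hα', β', hβ', rfl⟩
    refine ⟨α * α' + β * β' * b, F.add_mem (F.mul_mem hα hα') (F.mul_mem (F.mul_mem hβ hβ') hb),
      α * β' + β * α' + β * β' * a, F.add_mem (F.add_mem (F.mul_mem hα hβ') (F.mul_mem hβ hα'))
        (F.mul_mem (F.mul_mem hβ hβ') ha), ?_⟩
    linear_combination β * β' * hq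
  inv_mem' := by
    rintro _ ⟨α, hα, β, hβ, rfl⟩
    rcases eq_or_ne (α + β * u) 0 with h0 | h0
    · exact ⟨0, F.zero_mem, 0, F.zero_mem, by rw [h0]; simp⟩
    have hn : (α + β * u) * (α + β * a + -β * u) = α * (α + β * a) - β * β * b := by
      linear_combination (-β * β) * hq
    have hc0 : α + β * a + -β * u ≠ 0 := by
      intro h
      rw [add_mul_eq_zero_iff hu (F.add_mem hα (F.mul_mem hβ ha)) (F.neg_mem hβ)] at h
      obtain ⟨h1, h2⟩ := h
      rw [neg_eq_zero] at h2
      subst h2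
      apply h0
      simpa using h1
    have hnF : α * (α + β * a) - β * β * b ∈ F :=
      F.sub_mem (F.mul_mem hα (F.add_mem hα (F.mul_mem hβ ha))) (F.mul_mem (F.mul_mem hβ hβ) hb)
    have hn0 := mul_ne_zero h0 hc0
    refine ⟨(α + β * a) / ((α + β * u) * (α + β * a + -β * u)),
      F.div_mem (F.add_mem hα (F.mul_mem hβ ha)) (hn ▸ hnF),
      -β / ((α + β * u) * (α + β * a + -β * u)), F.div_mem (F.neg_mem hβ) (hn ▸ hnF), ?_⟩
    generalize α + β * u = x at *
    have : (α + β * a) / (x * (α + β * a + -β * u)) + -β / (x * (α + β * a + -β * u)) * u =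
      (α + β * a + -β * u) / (x * (α + β * a + -β * u)) := by ring
    rw [this, mul_comm x, ← div_div, div_self hc0, one_div]

/-- A set that is, up to scaling, the inverse of `F + F u` as seen from two of its points is a
multiple of a quadratic extension field of `F`. -/
theorem exists_quadratic (hF : 2 ≤ (F : Set C).ncard) {A : Set C}
    (hA : A.ncard = (F : Set C).ncard ^ 2) {z₁ u' : C} (hz : z₁ ≠ 0) (hu : u ∉ F) (hu' : u' ∉ F)
    (h0A : 0 ∈ A) (h1A : z₁ ∈ A) (h0 : ∀ p ∈ linSpan F u, p ≠ 0 → z₁ / p ∈ A)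
    (h1 : ∀ p ∈ linSpan F u', p ≠ 0 → z₁ - z₁ / p ∈ A) :
    ∃ a ∈ F, ∃ b ∈ F, u * u = a * u + b ∧ A = (fun p => z₁ * p) '' linSpan F u := by
  have hpos : 0 < (F : Set C).ncard ^ 2 := by positivity
  have hAfin : A.Finite := Set.finite_of_ncard_ne_zero (by omega)
  have hMfin : (linSpan F u).Finite :=
    Set.finite_of_ncard_ne_zero (by rw [ncard_linSpan hu]; omega)
  have hMfin' : (linSpan F u').Finite :=
    Set.finite_of_ncard_ne_zero (by rw [ncard_linSpan hu']; omega)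
  have eA : (fun p => z₁ * p⁻¹) '' linSpan F u = A := by
    apply Set.eq_of_subset_of_ncard_le _ _ hAfin
    · rintro _ ⟨p, hp, rfl⟩
      rcases eq_or_ne p 0 with rfl | hp0
      · simpa using h0A
      · simpa [div_eq_mul_inv] using h0 p hp hp0
    · rw [Set.ncard_image_of_injective, ncard_linSpan hu, hA]
      intro p p' h
      exact inv_injective (mul_left_cancel₀ hz h)
  have eA' : (fun p => z₁ - z₁ * p⁻¹) '' linSpan F u' = A := by
    apply Set.eq_of_subset_of_ncard_le _ _ hAfin
    · rintro _ ⟨p, hp, rfl⟩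
      rcases eq_or_ne p 0 with rfl | hp0
      · simpa using h1A
      · simpa [div_eq_mul_inv] using h1 p hp hp0
    · rw [Set.ncard_image_of_injective, ncard_linSpan hu', hA]
      intro p p' h
      exact inv_injective (mul_left_cancel₀ hz (sub_right_injective h))
  have hone : ∀ v : C, ∀ x ∈ linSpan F v, ∀ f ∈ F, x + f ∈ linSpan F v := by
    rintro v _ ⟨α, hα, β, hβ, rfl⟩ f hf
    exact ⟨α + f, F.add_mem hα hf, β, hβ, by ring⟩
  have hinv : ∀ r ∈ linSpan F u, r⁻¹ ∈ linSpan F u' := by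
    intro r hr
    rcases eq_or_ne r 0 with rfl | hr0
    · exact ⟨0, F.zero_mem, 0, F.zero_mem, by simp⟩
    rcases eq_or_ne (r + 1) 0 with hr1 | hr1
    · rw [eq_neg_of_add_eq_zero_left hr1]
      exact ⟨-1, F.neg_mem F.one_mem, 0, F.zero_mem, by norm_num⟩
    have : z₁ * (r + 1)⁻¹ ∈ A := by
      rw [← eA]; exact ⟨_, hone _ _ hr 1 F.one_mem, rfl⟩
    rw [← eA'] at this
    obtain ⟨p, hp, e⟩ := this
    have e1 : p⁻¹ = r / (r + 1) := by
      apply mul_left_cancel₀ hz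
      simp only at e
      rw [← sub_eq_zero]
      have : z₁ * (r / (r + 1)) = z₁ - z₁ * (r + 1)⁻¹ := by field_simp; ring
      rw [this]
      linear_combination -e
    have e2 : p = r⁻¹ + 1 := by
      rw [← inv_inv p, e1]; field_simp; ring
    have := hone _ _ hp (-1) (F.neg_mem F.one_mem)
    rwa [e2, add_neg_cancel_right] at this
  have eM : (fun p => p⁻¹) '' linSpan F u = linSpan F u' := by
    apply Set.eq_of_subset_of_ncard_le _ _ hMfin'
    · rintro _ ⟨p, hp, rfl⟩; exact hinv p hp
    · rw [Set.ncard_image_of_injective _ inv_injective, ncard_linSpan hu, ncard_linSpan hu']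
  have huM : u ∈ linSpan F u := ⟨0, F.zero_mem, 1, F.one_mem, by simp⟩
  have hu0 : u ≠ 0 := fun h => hu (h ▸ F.zero_mem)
  have h2 := hone _ _ (hinv u huM) 1 F.one_mem
  rw [← eM] at h2
  obtain ⟨r, ⟨α, hα, β, hβ, rfl⟩, e⟩ := h2
  have hr0 : α + β * u ≠ 0 := by
    intro h
    simp only at e
    rw [h, inv_zero] at e
    apply hu
    have : u = -1 := by
      field_simp at e
      linear_combination -e
    rw [this]
    exact F.neg_mem F.one_mem
  have e3 : u = (1 + u) * (α + β * u) := by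
    have e' : (α + β * u)⁻¹ = u⁻¹ + 1 := e
    have : (u * (α + β * u)) * (α + β * u)⁻¹ = (u * (α + β * u)) * (u⁻¹ + 1) := by rw [e']
    rw [mul_assoc, mul_inv_cancel₀ hr0, mul_one] at this
    nth_rewrite 1 [this]
    field_simp
  have hβ0 : β ≠ 0 := by
    rintro rfl
    have h3 := (add_mul_eq_zero_iff hu hα (F.sub_mem hα F.one_mem)).mp
      (by linear_combination -e3)
    apply one_ne_zero (α := C)
    linear_combination h3.1 - h3.2
  have ha : (1 - α - β) / β ∈ F := F.div_mem (F.sub_mem (F.sub_mem F.one_mem hα) hβ) hβ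
  have hb : -α / β ∈ F := F.div_mem (F.neg_mem hα) hβ
  have hquad : u * u = (1 - α - β) / β * u + -α / β := by
    field_simp
    linear_combination -e3
  refine ⟨_, ha, _, hb, hquad, ?_⟩
  rw [← eA]
  ext x
  constructor
  · rintro ⟨p, hp, rfl⟩
    exact ⟨p⁻¹, (quadSubfield hu ha hb hquad).inv_mem hp, rfl⟩
  · rintro ⟨p, hp, rfl⟩
    exact ⟨p⁻¹, (quadSubfield hu ha hb hquad).inv_mem hp, by simp⟩

theorem exists_scaled {N : Set (C × C)}
    (hadd : ∀ u z, (u, z) ∈ N → ∀ f ∈ F, (u + f, z) ∈ N)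
    (hopp : ∀ u z, (u, z) ∈ N → u ∉ F → ∀ f ∈ F, f ≠ 0 → (u * f / (u + f), z * f / (u + f)) ∈ N)
    {z : C} (h : (u, z) ∈ N) (hu : u ∉ F) {p : C} (hp : p ∈ linSpan F u) (hp0 : p ≠ 0) :
    ∃ u', (u', z / p) ∈ N := by
  have key : ∀ u z, (u, z) ∈ N → u ∉ F → ∀ α ∈ F, ∀ β ∈ F, β ≠ 0 →
      ∃ u', (u', z / (α + β * u)) ∈ N := by
    intro u z h hu α hα β hβ hβ0
    have hf : (α - 1) / β ∈ F := F.div_mem (F.sub_mem hα F.one_mem) hβ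
    have hu1 : u + (α - 1) / β ∉ F := fun h' => hu (by simpa using F.sub_mem h' hf)
    have := hopp _ _ (hadd u z h _ hf) hu1 β⁻¹ (F.inv_mem hβ) (inv_ne_zero hβ0)
    have e : u + (α - 1) / β + β⁻¹ = (α + β * u) / β := by field_simp; ring
    have e' : z * β⁻¹ / (u + (α - 1) / β + β⁻¹) = z / (α + β * u) := by rw [e]; field_simp
    rw [e'] at this
    exact ⟨_, this⟩
  obtain ⟨α, hα, β, hβ, rfl⟩ := hp
  rcases eq_or_ne β 0 with rfl | hβ0
  · have hα0 : α ≠ 0 := by simpa using hp0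
    have h1 := hopp u z h hu 1 F.one_mem one_ne_zero
    rw [mul_one, mul_one] at h1
    have hu1 : u + 1 ≠ 0 := fun h' => hu (by
      rw [eq_neg_of_add_eq_zero_left h']; exact F.neg_mem F.one_mem)
    have hu2 : u / (u + 1) ∉ F := by
      intro h'
      have e : u + 1 = (1 - u / (u + 1))⁻¹ := by
        have : 1 - u / (u + 1) = (u + 1)⁻¹ := by field_simp; ring
        rw [this, inv_inv]
      have h2 := F.sub_mem (F.inv_mem (F.sub_mem F.one_mem h')) F.one_mem
      rw [← e] at h2
      apply hu
      simpa using h2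
    obtain ⟨u', h'⟩ := key _ _ h1 hu2 α hα (-α) (F.neg_mem hα) (neg_ne_zero.mpr hα0)
    have e : α + -α * (u / (u + 1)) = α / (u + 1) := by field_simp; ring
    rw [e, div_div_div_cancel_right₀ hu1] at h'
    exact ⟨u', by simpa using h'⟩
  · exact key u z h hu α hα β hβ hβ0

end SubfieldSpan

namespace IsLinSubunital

variable {C : Type*} [Field C] {R : Subfield C} {σ : C →+* C} {ε : C} {q : ℕ}
  {U : Set (Projectivization C (Fin 3 → C))}

/-- The translations with centre `[0,1,0]` are parametrized by a multiple of a subfield. -/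
theorem exists_subfield (hσ : IsQuadConj R σ) (hε : ε ∉ R) (hq : 2 ≤ q)
    (hU : IsLinSubunital R σ ε q U)
    (hinf : Projectivization.mk C ![0, 1, 0] vec_zero_one_zero_ne_zero ∈ U)
    (h0 : (0, 0) ∈ affinePart U) :
    ∃ τ ∈ R, τ ≠ 0 ∧ ∃ F : Subfield C, F ≤ R ∧ (F : Set C).ncard = q ∧
      ∀ y z, (y, z) ∈ affinePart U →
        ∀ y', (y', z) ∈ affinePart U ↔ ∃ f ∈ F, y' = y + ε * (τ * f) := by
  obtain ⟨T, hTR, hTq, hT⟩ :=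
    (hU.isAffineSubunital hσ hε hq hinf).exists_translations hσ hε hq
  obtain ⟨hTinv, -⟩ := hU.opposite_translations hσ hε hq hinf h0 hT
  have hTfin : (T : Set C).Finite := Set.finite_of_ncard_ne_zero (by omega)
  obtain ⟨τ, hτ, hτ0⟩ := Set.exists_ne_of_one_lt_ncard (s := (T : Set C)) (by omega) 0
  let T₁ : AddSubgroup C := T.comap (AddMonoidHom.mulLeft τ)
  have hT₁ : ∀ x, x ∈ T₁ ↔ τ * x ∈ T := fun x => Iff.rfl
  have himg : (fun x => τ * x) '' (T₁ : Set C) = T := by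
    ext x
    constructor
    · rintro ⟨y, hy, rfl⟩; exact hy
    · intro hx
      have e : τ * (x / τ) = x := by field_simp
      exact ⟨x / τ, by rw [SetLike.mem_coe, hT₁, e]; exact hx, e⟩
  have hT₁fin : (T₁ : Set C).Finite := by
    apply Set.Finite.of_finite_image _ (mul_right_injective₀ hτ0).injOn
    rw [himg]; exact hTfin
  have h1 : (1 : C) ∈ T₁ := by rw [hT₁, mul_one]; exact hτ
  have hinv : ∀ x ∈ T₁, x⁻¹ ∈ T₁ := by
    intro x hx
    rcases eq_or_ne x 0 with rfl | hx0
    · simp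
    rcases eq_or_ne x 1 with rfl | hx1
    · simpa using h1
    have hx1' : x - 1 ≠ 0 := sub_ne_zero.mpr hx1
    have h2 := hTinv (τ * (x - 1)) (T₁.sub_mem hx h1) (τ * 1) h1 (mul_ne_zero hτ0 hx1')
      (mul_ne_zero hτ0 one_ne_zero) (by
        rw [← mul_add]; exact mul_ne_zero hτ0 (by simpa using hx0))
    have e : ((τ * (x - 1))⁻¹ + (τ * 1)⁻¹)⁻¹ = τ * (1 - x⁻¹) := by
      have : (τ * (x - 1))⁻¹ + (τ * 1)⁻¹ = x / (τ * (x - 1)) := by field_simp; ring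
      rw [this]
      field_simp
    rw [e, ← hT₁] at h2
    simpa using T₁.sub_mem h1 h2
  let F : Subfield C :=
    { carrier := T₁
      zero_mem' := T₁.zero_mem
      one_mem' := h1
      add_mem' := T₁.add_mem
      neg_mem' := T₁.neg_mem
      mul_mem' := mul_mem_of_inv_closed T₁ hT₁fin h1 hinv
      inv_mem' := hinv }
  have hF : ∀ x, x ∈ F ↔ τ * x ∈ T := fun x => Iff.rfl
  refine ⟨τ, hTR τ hτ, hτ0, F, ?_, ?_, ?_⟩
  · intro x hx
    have := R.div_mem (hTR _ ((hF x).mp hx)) (hTR τ hτ)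
    rwa [mul_div_cancel_left₀ _ hτ0] at this
  · rw [← hTq, ← himg, Set.ncard_image_of_injective _ (mul_right_injective₀ hτ0)]
    rfl
  · intro y z h y'
    rw [hT y z h]
    constructor
    · rintro ⟨s, hs, rfl⟩
      have e : τ * (s / τ) = s := by field_simp
      exact ⟨s / τ, by rw [hF, e]; exact hs, by rw [e]⟩
    · rintro ⟨f, hf, rfl⟩
      exact ⟨τ * f, hf, rfl⟩

theorem coord_notMem (hσ : IsQuadConj R σ) (hε : ε ∉ R) (hU : IsLinSubunital R σ ε q U)
    {τ u z : C} (hτ : τ ∈ R) (h : (ε * τ * u, z) ∈ affinePart U) (hz : z ≠ 0) : u ∉ R := by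
  intro hu
  obtain ⟨r, hr, e⟩ := hU.herm _ _ h
  simp only [Matrix.cons_val_zero, Matrix.cons_val_one, Matrix.cons_val, map_one, one_mul] at e
  have hN0 : σ z * z ≠ 0 := mul_ne_zero ((map_ne_zero σ).mpr hz) hz
  have e' : σ z * z = ε * (r - τ * u) := by linear_combination e
  have hr0 : r - τ * u ≠ 0 := by
    intro h; rw [h, mul_zero] at e'; exact hN0 e'
  apply hε
  rw [eq_div_of_mul_eq hr0 e'.symm]
  exact R.div_mem (hσ.norm_mem _) (R.sub_mem hr (R.mul_mem hτ hu))

theorem scaled_mem (hσ : IsQuadConj R σ) (hε : ε ∉ R) (hq : 2 ≤ q)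
    (hU : IsLinSubunital R σ ε q U)
    (hinf : Projectivization.mk C ![0, 1, 0] vec_zero_one_zero_ne_zero ∈ U)
    (h0 : (0, 0) ∈ affinePart U) {τ : C} (hτ : τ ∈ R) (hτ0 : τ ≠ 0) {F : Subfield C} (hFR : F ≤ R)
    (hF : ∀ y z, (y, z) ∈ affinePart U →
      ∀ y', (y', z) ∈ affinePart U ↔ ∃ f ∈ F, y' = y + ε * (τ * f))
    {u z p : C} (h : (ε * τ * u, z) ∈ affinePart U) (hz : z ≠ 0) (hp : p ∈ linSpan F u)
    (hp0 : p ≠ 0) : z / p ∈ Prod.snd '' affinePart U := by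
  have hε0 : ε ≠ 0 := fun h => hε (h ▸ R.zero_mem)
  let T : AddSubgroup C := F.toSubring.toAddSubgroup.map (AddMonoidHom.mulLeft τ)
  have hTmem : ∀ s, s ∈ T ↔ ∃ f ∈ F, τ * f = s := fun s => Iff.rfl
  have hT : ∀ y z, (y, z) ∈ affinePart U →
      ∀ y', (y', z) ∈ affinePart U ↔ ∃ s ∈ T, y' = y + ε * s := by
    intro y z h y'
    rw [hF y z h]
    simp [hTmem]
  obtain ⟨-, hopp⟩ := hU.opposite_translations hσ hε hq hinf h0 hT
  let N : Set (C × C) := {p | (ε * τ * p.1, p.2) ∈ affinePart U}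
  have hu := hU.coord_notMem hσ hε hτ h hz
  obtain ⟨u', hu'⟩ := exists_scaled (F := F) (N := N) (u := u) (z := z) (p := p) (by
      intro u z h f hf
      exact (hF _ _ h _).mpr ⟨f, hf, by ring⟩) (by
      intro u z h hu f hf hf0
      have hu0 : u ≠ 0 := fun h => hu (h ▸ F.zero_mem)
      have huf : u + f ≠ 0 := fun h => hu (by
        rw [eq_neg_of_add_eq_zero_left h]; exact F.neg_mem hf)
      have := hopp (τ * f) ⟨f, hf, rfl⟩ (mul_ne_zero hτ0 hf0) _ _ h
        (mul_ne_zero (mul_ne_zero hε0 hτ0) hu0) (by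
          rw [← mul_assoc, ← mul_add]
          exact mul_ne_zero (mul_ne_zero hε0 hτ0) huf)
      have e : (ε * τ * u)⁻¹ + (ε * (τ * f))⁻¹ = (u + f) / (ε * τ * u * f) := by
        field_simp; ring
      have e1 : ((ε * τ * u)⁻¹ + (ε * (τ * f))⁻¹)⁻¹ = ε * τ * (u * f / (u + f)) := by
        rw [e]; field_simp
      have e2 : z / (ε * τ * u) / ((ε * τ * u)⁻¹ + (ε * (τ * f))⁻¹) = z * f / (u + f) := by
        rw [e]; field_simp
      rw [e1, e2] at this
      exact this) h (fun h' => hu (hFR h')) hp hp0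
  exact ⟨_, hu', rfl⟩

theorem exists_linSpan (hσ : IsQuadConj R σ) (hε : ε ∉ R) (hq : 2 ≤ q)
    (hU : IsLinSubunital R σ ε q U)
    (hinf : Projectivization.mk C ![0, 1, 0] vec_zero_one_zero_ne_zero ∈ U)
    {τ : C} (hτ : τ ∈ R) (hτ0 : τ ≠ 0) {F : Subfield C} (hFR : F ≤ R)
    (hF : ∀ y z, (y, z) ∈ affinePart U →
      ∀ y', (y', z) ∈ affinePart U ↔ ∃ f ∈ F, y' = y + ε * (τ * f))
    {y₀ z₀ y₁ z₁ : C} (h0 : (y₀, z₀) ∈ affinePart U) (h1 : (y₁, z₁) ∈ affinePart U)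
    (hne : z₁ ≠ z₀) :
    ∃ u ∉ R, ∀ p ∈ linSpan F u, p ≠ 0 → z₀ + (z₁ - z₀) / p ∈ Prod.snd '' affinePart U := by
  have hε0 : ε ≠ 0 := fun h => hε (h ▸ R.zero_mem)
  obtain ⟨e, hU', hinf', β, hβ⟩ := hU.exists_shear hσ hε h0
  rw [← hinf'] at hinf
  set U' := Projectivization.map e.toLinearMap e.injective '' U
  have hβ' : ∀ y z, (y, z) ∈ affinePart U' ↔ (y + y₀ - β * z, z + z₀) ∈ affinePart U := by
    intro y z
    rw [← hβ]
    have e1 : y + y₀ - β * z - y₀ + β * (z + z₀ - z₀) = y := by ring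
    have e2 : z + z₀ - z₀ = z := by ring
    rw [e1, e2]
  have hF' : ∀ y z, (y, z) ∈ affinePart U' →
      ∀ y', (y', z) ∈ affinePart U' ↔ ∃ f ∈ F, y' = y + ε * (τ * f) := by
    intro y z h y'
    rw [hβ'] at h ⊢
    rw [hF _ _ h]
    apply exists_congr
    intro f
    apply and_congr_right
    intro _
    constructor <;> intro h <;> linear_combination h
  have h0' : (0, 0) ∈ affinePart U' := by rw [hβ']; simpa using h0
  have hz : z₁ - z₀ ≠ 0 := sub_ne_zero.mpr hne
  have h1' : (ε * τ * ((y₁ - y₀ + β * (z₁ - z₀)) / (ε * τ)), z₁ - z₀) ∈ affinePart U' := by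
    rw [mul_div_cancel₀ _ (mul_ne_zero hε0 hτ0)]
    exact (hβ _ _).mpr h1
  refine ⟨_, hU'.coord_notMem hσ hε hτ h1' hz, ?_⟩
  intro p hp hp0
  obtain ⟨⟨y, z⟩, h, e⟩ := hU'.scaled_mem hσ hε hq hinf h0' hτ hτ0 hFR hF' h1' hz hp hp0
  rw [hβ'] at h
  exact ⟨_, h, by rw [← e]; exact add_comm _ _⟩

end IsLinSubunital

section Arithmetic

variable {C : Type*} [Field C] {R F : Subfield C} {σ : C →+* C} {q : ℕ} {u a b : C}

theorem isPrimePow_and_pow_eq (hσ : IsQuadConj R σ) (hFR : F ≤ R) (hF : (F : Set C).ncard = q)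
    (hq : 2 ≤ q) (hu : u ∉ R) (ha : a ∈ F) (hb : b ∈ F) (hquad : u * u = a * u + b) :
    IsPrimePow q ∧ ∀ e ∈ linSpan F u, e ^ q = σ e := by
  have hFfin : Finite F := (Set.finite_of_ncard_ne_zero (by omega) : (F : Set C).Finite)
  have := Fintype.ofFinite F
  have hcard : Fintype.card F = q := by
    rw [← hF, ← Nat.card_eq_fintype_card]; rfl
  obtain ⟨p, hp⟩ := CharP.exists F
  obtain ⟨n, hpp, hn⟩ := FiniteField.card F p
  have : Fact p.Prime := ⟨hpp⟩
  have : CharP C p := (RingHom.charP_iff F.subtype F.subtype.injective p).mp hp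
  have hqn : q = p ^ (n : ℕ) := hcard ▸ hn
  have hadd : ∀ x y : C, (x + y) ^ q = x ^ q + y ^ q := by
    intro x y; rw [hqn, add_pow_char_pow]
  have hpow : ∀ f ∈ F, f ^ q = f := by
    intro f hf
    have := FiniteField.pow_card (⟨f, hf⟩ : F)
    rw [hcard] at this
    exact congrArg Subtype.val this
  have hne : u ^ q ≠ u := by
    intro h
    have h0 := FiniteField.X_pow_card_sub_X_ne_zero C (p := q) (by omega)
    have hdeg := FiniteField.X_pow_card_sub_X_natDegree_eq C (p := q) (by omega)
    have hsub : insert u (F : Set C) ⊆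
        (Polynomial.X ^ q - Polynomial.X : Polynomial C).rootSet C := by
      intro x hx
      rw [Polynomial.mem_rootSet_of_ne h0]
      rcases hx with rfl | hx
      · simp [h]
      · simp [hpow x hx]
    have h1 := Set.ncard_le_ncard hsub (Polynomial.rootSet_finite _ _)
    rw [Set.ncard_insert_of_notMem (fun h => hu (hFR h)) hFfin, hF] at h1
    have h2 := Polynomial.ncard_rootSet_le (Polynomial.X ^ q - Polynomial.X : Polynomial C) C
    rw [hdeg] at h2
    omega
  have huq : u ^ q = a - u := by
    have h1 : (u * u) ^ q = (a * u + b) ^ q := by rw [hquad]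
    rw [hadd, mul_pow, mul_pow, hpow a ha, hpow b hb] at h1
    have h2 : (u ^ q - u) * (u ^ q - (a - u)) = 0 := by linear_combination h1 - hquad
    exact sub_eq_zero.mp ((mul_eq_zero.mp h2).resolve_left (sub_ne_zero.mpr hne))
  have hσu : σ u = a - u := by
    have h1 := (add_mul_eq_zero_iff hu (α := b + σ u * u) (β := a - (u + σ u))
      (R.add_mem (hFR hb) (hσ.norm_mem u)) (R.sub_mem (hFR ha) (hσ.trace_mem u))).mp
      (by linear_combination -hquad)
    linear_combination -h1.2
  refine ⟨hqn ▸ hpp.isPrimePow.pow n.ne_zero, ?_⟩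
  rintro _ ⟨α, hα, β, hβ, rfl⟩
  rw [hadd, mul_pow, hpow α hα, hpow β hβ, huq, map_add, map_mul, hσ.fix α (hFR hα),
    hσ.fix β (hFR hβ), hσu]

theorem linSpan_inter (hFR : F ≤ R) (hu : u ∉ R) {x : C} (hx : x ∈ linSpan F u) (hxR : x ∈ R) :
    x ∈ F := by
  obtain ⟨α, hα, β, hβ, rfl⟩ := hx
  have := (add_mul_eq_zero_iff hu (R.sub_mem (hFR hα) hxR) (hFR hβ)).mp (by ring)
  rw [this.2]
  simpa using hα

end Arithmetic

/-- `U` is projectively equivalent to a hermitian unital over a finite subfield. -/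
def IsStandard {C : Type*} [Field C] (R : Subfield C) (q : ℕ)
    (U : Set (Projectivization C (Fin 3 → C))) : Prop :=
  IsPrimePow q ∧
    ∃ (E : Subfield C) (ε' : C) (g : Matrix (Fin 3) (Fin 3) C),
      Nat.card E = q ^ 2 ∧ Nat.card ↥(E ⊓ R) = q ∧
      ε' ∈ E ∧ ε' ∉ R ∧ IsUnit g ∧
      U = {P | ∃ v : Fin 3 → C, (∀ i, v i ∈ E) ∧ v ≠ 0 ∧
            (∃ f ∈ E ⊓ R, v 0 ^ q * v 1 + v 2 ^ (q + 1) = ε' * f) ∧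
            ∃ hgv : g.mulVec v ≠ 0, P = Projectivization.mk C (g.mulVec v) hgv}

theorem IsStandard.of_map {C : Type*} [Field C] {R : Subfield C} {q : ℕ}
    {U : Set (Projectivization C (Fin 3 → C))} (e : (Fin 3 → C) ≃ₗ[C] (Fin 3 → C))
    (h : IsStandard R q (Projectivization.map e.toLinearMap e.injective '' U)) :
    IsStandard R q U := by
  obtain ⟨hq, E, ε', g, hE, hF, hε'E, hε'R, hg, hU⟩ := h
  have hM : ∀ v, (LinearMap.toMatrix' e.symm.toLinearMap * g).mulVec v = e.symm (g.mulVec v) := by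
    intro v
    rw [← Matrix.mulVec_mulVec, LinearMap.toMatrix'_mulVec]
    rfl
  have hunit : IsUnit (LinearMap.toMatrix' e.symm.toLinearMap) := by
    apply IsUnit.of_mul_eq_one (LinearMap.toMatrix' e.toLinearMap)
    rw [← LinearMap.toMatrix'_comp]
    simp
  refine ⟨hq, E, ε', LinearMap.toMatrix' e.symm.toLinearMap * g, hE, hF, hε'E, hε'R,
    hunit.mul hg, ?_⟩
  ext P
  have hinj := Projectivization.map_injective e.toLinearMap e.injective
  rw [← hinj.mem_set_image, hU]
  apply exists_congr
  intro v
  refine and_congr_right fun _ => and_congr_right fun _ => and_congr_right fun _ => ?_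
  induction P using Projectivization.ind with
  | h w hw =>
    have hne : (LinearMap.toMatrix' e.symm.toLinearMap * g).mulVec v ≠ 0 ↔ g.mulVec v ≠ 0 := by
      rw [hM, Ne, LinearEquiv.map_eq_zero_iff]
    constructor
    · rintro ⟨hgv, h⟩
      refine ⟨hne.mpr hgv, ?_⟩
      rw [Projectivization.map_mk, Projectivization.mk_eq_mk_iff'] at h
      obtain ⟨c, hc⟩ := h
      rw [Projectivization.mk_eq_mk_iff']
      refine ⟨c, ?_⟩
      rw [hM, ← map_smul, hc]
      exact e.symm_apply_apply w
    · rintro ⟨hgv, h⟩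
      refine ⟨hne.mp hgv, ?_⟩
      rw [Projectivization.mk_eq_mk_iff'] at h
      obtain ⟨c, hc⟩ := h
      rw [Projectivization.map_mk, Projectivization.mk_eq_mk_iff']
      refine ⟨c, ?_⟩
      rw [← hc, hM]
      simp

namespace IsLinSubunital

variable {C : Type*} [Field C] {R : Subfield C} {σ : C →+* C} {ε : C} {q : ℕ}
  {U : Set (Projectivization C (Fin 3 → C))}

theorem exists_coordinates (hσ : IsQuadConj R σ) (hε : ε ∉ R) (hq : 2 ≤ q)
    (hU : IsLinSubunital R σ ε q U)
    (hinf : Projectivization.mk C ![0, 1, 0] vec_zero_one_zero_ne_zero ∈ U)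
    (h0 : (0, 0) ∈ affinePart U) :
    IsPrimePow q ∧ ∃ F ≤ R, (F : Set C).ncard = q ∧ ∃ E : Subfield C,
      (E : Set C).ncard = q ^ 2 ∧ E ⊓ R = F ∧ (∀ e ∈ E, e ^ q = σ e) ∧
      ∃ u ∈ E, u ∉ R ∧ ∃ c ≠ 0, ∃ z₁ ≠ 0, ∀ y z, (y, z) ∈ affinePart U ↔
        ∃ e ∈ E, ∃ f ∈ F, y = c * (e ^ (q + 1) * u + f) ∧ z = z₁ * e := by
  have hε0 : ε ≠ 0 := fun h => hε (h ▸ R.zero_mem)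
  obtain ⟨τ, hτ, hτ0, F, hFR, hFq, hF⟩ := hU.exists_subfield hσ hε hq hinf h0
  have hA := (hU.isAffineSubunital hσ hε hq hinf).ncard_image_snd hq
  obtain ⟨_, ⟨⟨y₁, z₁⟩, h1, rfl⟩, hz₁⟩ : ∃ z ∈ Prod.snd '' affinePart U, z ≠ 0 :=
    Set.exists_ne_of_one_lt_ncard (by rw [hA]; nlinarith) 0
  change z₁ ≠ 0 at hz₁
  have hc0 : ε * τ ≠ 0 := mul_ne_zero hε0 hτ0
  obtain ⟨u, rfl⟩ : ∃ u, y₁ = ε * τ * u := ⟨y₁ / (ε * τ), by field_simp⟩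
  have hu := hU.coord_notMem hσ hε hτ h1 hz₁
  obtain ⟨u', hu', hbase⟩ :=
    hU.exists_linSpan hσ hε hq hinf hτ hτ0 hFR hF h1 h0 hz₁.symm
  obtain ⟨a, ha, b, hb, hquad, hAE⟩ := exists_quadratic (F := F)
    (A := Prod.snd '' affinePart U) (u := u) (u' := u')
    (by omega) (by rw [hA, hFq]) hz₁ (fun h => hu (hFR h)) (fun h => hu' (hFR h))
    ⟨_, h0, rfl⟩ ⟨_, h1, rfl⟩
    (fun p hp hp0 => hU.scaled_mem hσ hε hq hinf h0 hτ hτ0 hFR hF h1 hz₁ hp hp0)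
    (fun p hp hp0 => by
      have := hbase p hp hp0
      rwa [zero_sub, neg_div, ← sub_eq_add_neg] at this)
  obtain ⟨hpp, hpow⟩ := isPrimePow_and_pow_eq hσ hFR hFq hq hu ha hb hquad
  let E : Subfield C := quadSubfield (fun h => hu (hFR h)) ha hb hquad
  have hE : ∀ x, x ∈ E ↔ x ∈ linSpan F u := fun x => Iff.rfl
  have hFE : F ≤ E := fun f hf => ⟨f, hf, 0, F.zero_mem, by simp⟩
  have huE : u ∈ E := ⟨0, F.zero_mem, 1, F.one_mem, by simp⟩
  have hmem : ∀ z, z₁ * z ∈ Prod.snd '' affinePart U ↔ z ∈ E := by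
    intro z
    rw [hAE]
    constructor
    · rintro ⟨p, hp, h⟩
      rwa [← mul_left_cancel₀ hz₁ h]
    · intro h; exact ⟨z, h, rfl⟩
  have hherm : ∀ v z, (ε * τ * v, z) ∈ affinePart U → v + σ z * z / (ε * τ) ∈ R := by
    intro v z h
    obtain ⟨r, hr, e⟩ := hU.herm _ _ h
    simp only [Matrix.cons_val_zero, Matrix.cons_val_one, Matrix.cons_val, map_one, one_mul] at e
    have : v + σ z * z / (ε * τ) = r / τ := by
      field_simp
      linear_combination e
    rw [this]
    exact R.div_mem hr hτ
  have hcoord : ∀ v, ∀ e ∈ E, (ε * τ * v, z₁ * e) ∈ affinePart U →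
      ∃ f ∈ F, v = e ^ (q + 1) * u + f := by
    intro v e he h
    rcases eq_or_ne e 0 with rfl | he0
    · rw [mul_zero] at h
      obtain ⟨f, hf, h'⟩ := (hF _ _ h0 _).mp h
      refine ⟨f, hf, mul_left_cancel₀ hc0 ?_⟩
      rw [h']; ring
    have hze := mul_ne_zero hz₁ he0
    have hv := hU.coord_notMem hσ hε hτ h hze
    have hv0 : v ≠ 0 := fun h => hv (h ▸ R.zero_mem)
    have hvE : v ∈ E := by
      have h2 := hU.scaled_mem hσ hε hq hinf h0 hτ hτ0 hFR hF h hze (p := v)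
        ⟨0, F.zero_mem, 1, F.one_mem, by simp⟩ hv0
      rw [mul_div_assoc, hmem] at h2
      have := E.mul_mem he (E.inv_mem h2)
      rwa [inv_div, mul_div_cancel₀ _ he0] at this
    have hN := hσ.norm_mem e
    have hR : v - e ^ (q + 1) * u ∈ R := by
      have h2 := R.sub_mem (hherm _ _ h) (R.mul_mem hN (hherm _ _ h1))
      have e2 : v + σ (z₁ * e) * (z₁ * e) / (ε * τ) - σ e * e * (u + σ z₁ * z₁ / (ε * τ)) =
          v - e ^ (q + 1) * u := by
        rw [pow_succ, hpow e he, map_mul]; ring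
      rwa [e2] at h2
    exact ⟨_, linSpan_inter hFR hu (E.sub_mem hvE (E.mul_mem (E.pow_mem he _) huE)) hR, by ring⟩
  refine ⟨hpp, F, hFR, hFq, E, ?_, ?_, hpow, u, huE, hu, ε * τ, hc0, z₁, hz₁, ?_⟩
  · rw [← hFq]
    exact ncard_linSpan fun h => hu (hFR h)
  · apply le_antisymm
    · rintro x ⟨hx, hxR⟩
      exact linSpan_inter hFR hu hx hxR
    · exact le_inf hFE hFR
  · intro y z
    constructor
    · intro h
      have hz : z = z₁ * (z / z₁) := by field_simp
      have he : z / z₁ ∈ E := (hmem _).mp (by rw [← hz]; exact ⟨_, h, rfl⟩)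
      have hy : y = ε * τ * (y / (ε * τ)) := by field_simp
      rw [hz, hy] at h
      obtain ⟨f, hf, e⟩ := hcoord _ _ he h
      exact ⟨_, he, f, hf, by rw [← e]; exact hy, hz⟩
    · rintro ⟨e, he, f, hf, rfl, rfl⟩
      obtain ⟨⟨y, z⟩, h, hz⟩ := (hmem e).mpr he
      change z = z₁ * e at hz
      subst hz
      have hy : y = ε * τ * (y / (ε * τ)) := by field_simp
      rw [hy] at h
      obtain ⟨f', hf', e'⟩ := hcoord _ _ he h
      rw [e'] at h
      exact (hF _ _ h _).mpr ⟨f - f', F.sub_mem hf hf', by ring⟩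

theorem isStandard_of_zero_mem (hσ : IsQuadConj R σ) (hε : ε ∉ R) (hq : 2 ≤ q)
    (hU : IsLinSubunital R σ ε q U)
    (hinf : Projectivization.mk C ![0, 1, 0] vec_zero_one_zero_ne_zero ∈ U)
    (h0 : (0, 0) ∈ affinePart U) : IsStandard R q U := by
  obtain ⟨hpp, F, hFR, hFq, E, hEq, hEF, hpow, u, huE, hu, c, hc0, z₁, hz₁, hS⟩ :=
    hU.exists_coordinates hσ hε hq hinf h0
  have hu0 : u ≠ 0 := fun h => hu (h ▸ R.zero_mem)
  have hFE : F ≤ E := hEF ▸ inf_le_left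
  have hnorm : ∀ e ∈ E, e ^ (q + 1) ∈ R := by
    intro e he
    rw [pow_succ, hpow e he]
    exact hσ.norm_mem e
  have hmul : ∀ v : Fin 3 → C, (Matrix.diagonal ![1, -c * u, z₁]).mulVec v =
      ![v 0, -c * u * v 1, z₁ * v 2] := by
    intro v
    ext i; fin_cases i <;> simp [Matrix.mulVec_diagonal]
  refine ⟨hpp, E, u⁻¹, Matrix.diagonal ![1, -c * u, z₁], hEq, ?_, E.inv_mem huE,
    fun h => hu (by simpa using R.inv_mem h), ?_, ?_⟩
  · rw [hEF]; exact hFq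
  · rw [Matrix.isUnit_diagonal, Pi.isUnit_iff]
    intro i
    fin_cases i <;> simp [hc0, hu0, hz₁]
  have hne : ∀ v : Fin 3 → C, v ≠ 0 → ![v 0, -c * u * v 1, z₁ * v 2] ≠ 0 := by
    intro v hv h
    apply hv
    have h0 := congrFun h 0
    have h1 := congrFun h 1
    have h2 := congrFun h 2
    simp only [Matrix.cons_val_zero, Matrix.cons_val_one, Matrix.cons_val, Pi.zero_apply,
      mul_eq_zero, neg_eq_zero, hc0, hu0, hz₁, false_or, or_false] at h0 h1 h2
    ext i; fin_cases i <;> assumption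
  ext P
  constructor
  · intro hP
    rcases hU.eq_infty_or_affine hσ hε hP with rfl | ⟨y, z, rfl⟩
    · refine ⟨![0, 1, 0], ?_, vec_zero_one_zero_ne_zero, ⟨0, zero_mem _, by simp; omega⟩, ?_⟩
      · intro i; fin_cases i <;> simp
      · rw [hmul]
        refine ⟨hne _ vec_zero_one_zero_ne_zero, ?_⟩
        rw [Projectivization.mk_eq_mk_iff']
        refine ⟨(-c * u)⁻¹, ?_⟩
        have hcu : -c * u ≠ 0 := mul_ne_zero (neg_ne_zero.mpr hc0) hu0
        ext i; fin_cases i <;> simp [-neg_mul, -mul_inv_rev, hcu]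
    · obtain ⟨e, he, f, hf, hy, hz⟩ := (hS y z).mp hP
      have hv := one_cons_ne_zero (-(e ^ (q + 1) + u⁻¹ * f)) e
      refine ⟨![1, -(e ^ (q + 1) + u⁻¹ * f), e], ?_, hv, ⟨-f, ?_, ?_⟩, ?_⟩
      · have hmem := E.neg_mem (E.add_mem (E.pow_mem he (q + 1)) (E.mul_mem (E.inv_mem huE)
          (hFE hf)))
        intro i
        fin_cases i
        · exact E.one_mem
        · exact hmem
        · exact he
      · rw [hEF]; exact F.neg_mem hf
      · simp
      · rw [hmul]
        refine ⟨hne _ hv, ?_⟩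
        congr 1
        ext i
        fin_cases i
        · rfl
        · simp only [Fin.mk_one, Matrix.cons_val_one, Matrix.cons_val_zero, hy]
          field_simp
        · exact hz
  · rintro ⟨v, hvE, hv, ⟨f, hf, hvf⟩, hgv, rfl⟩
    simp only [hmul]
    by_cases hv0 : v 0 = 0
    · have hfR : f ∈ R := hf.2
      have hf0 : f = 0 := by
        by_contra hf0
        apply hu
        rw [hv0, zero_pow (by omega), zero_mul, zero_add] at hvf
        have := R.div_mem hfR (hnorm _ (hvE 2))
        rwa [hvf, div_mul_cancel_right₀ hf0, inv_inv] at this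
      have hv2 : v 2 = 0 := by
        rw [hv0, zero_pow (by omega), zero_mul, zero_add, hf0, mul_zero] at hvf
        exact eq_zero_of_pow_eq_zero hvf
      have hv1 : v 1 ≠ 0 := by
        intro hv1
        apply hv
        ext i; fin_cases i <;> assumption
      convert hinf using 1
      rw [Projectivization.mk_eq_mk_iff']
      refine ⟨-c * u * v 1, ?_⟩
      ext i; fin_cases i <;> simp [hv0, hv2]
    · have hmem : (-c * u * v 1 / v 0, z₁ * v 2 / v 0) ∈ affinePart U := by
        rw [hS]
        refine ⟨v 2 / v 0, E.div_mem (hvE 2) (hvE 0), -(f / v 0 ^ (q + 1)), ?_, ?_, by ring⟩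
        · rw [← hEF]
          exact neg_mem (div_mem hf ⟨E.pow_mem (hvE 0) _, hnorm _ (hvE 0)⟩)
        · have h2 : v 1 = (u⁻¹ * f - v 2 ^ (q + 1)) / v 0 ^ q := by
            field_simp
            field_simp at hvf
            linear_combination hvf
          rw [h2, div_pow]
          field_simp
          ring
      change Projectivization.mk C _ (one_cons_ne_zero _ _) ∈ U at hmem
      convert hmem using 1
      rw [Projectivization.mk_eq_mk_iff']
      refine ⟨v 0, ?_⟩
      ext i; fin_cases i <;> simp <;> field_simp

theorem isStandard_of_infty_mem (hσ : IsQuadConj R σ) (hε : ε ∉ R) (hq : 2 ≤ q)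
    (hU : IsLinSubunital R σ ε q U)
    (hinf : Projectivization.mk C ![0, 1, 0] vec_zero_one_zero_ne_zero ∈ U) :
    IsStandard R q U := by
  have hcard := (hU.isAffineSubunital hσ hε hq hinf).card
  obtain ⟨⟨y₀, z₀⟩, h0⟩ : (affinePart U).Nonempty :=
    Set.nonempty_of_ncard_ne_zero (by rw [hcard]; positivity)
  obtain ⟨e, hU', hinf', β, hβ⟩ := hU.exists_shear hσ hε h0
  refine IsStandard.of_map e (hU'.isStandard_of_zero_mem hσ hε hq (hinf'.mpr hinf) ?_)
  have := (hβ y₀ z₀).mpr h0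
  simpa only [sub_self, mul_zero, add_zero] using this

theorem isStandard (hσ : IsQuadConj R σ) (hε : ε ∉ R) (hq : 2 ≤ q)
    (hU : IsLinSubunital R σ ε q U) : IsStandard R q U := by
  by_cases hinf : Projectivization.mk C ![0, 1, 0] vec_zero_one_zero_ne_zero ∈ U
  · exact hU.isStandard_of_infty_mem hσ hε hq hinf
  obtain ⟨P, hP⟩ : U.Nonempty := Set.nonempty_of_ncard_ne_zero (by rw [hU.card]; positivity)
  rcases hU.eq_infty_or_affine hσ hε hP with rfl | ⟨y₀, z₀, rfl⟩
  · exact absurd hP hinf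
  obtain ⟨e, hU', -, β, hβ⟩ := hU.exists_shear hσ hε hP
  have h0 := (hβ y₀ z₀).mpr hP
  simp only [sub_self, mul_zero, add_zero] at h0
  exact IsStandard.of_map e (IsStandard.of_map swapEquiv ((hU'.swap hσ).isStandard_of_infty_mem hσ
    (fun h => hε ((hσ.mem_iff ε).mp h)) hq (infty_mem_swap.mpr h0)))

end IsLinSubunital

theorem isQuadConj_of_finrank {C : Type*} [Field C] (R : Subfield C) (ε t d : C) (σ : C →+* C)
    (hrank : Module.finrank R C = 2) (hε : ε ∉ R) (ht : t ∈ R) (hd : d ∈ R)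
    (hmin : ε ^ 2 - t * ε + d = 0) (hσR : ∀ r ∈ R, σ r = r) (hσε : σ ε = t - ε) :
    IsQuadConj R σ := by
  have hli : LinearIndependent R ![1, ε] := by
    rw [LinearIndependent.pair_iff]
    rintro ⟨α, hα⟩ ⟨β, hβ⟩ h
    have := (add_mul_eq_zero_iff hε hα hβ).mp (by simpa [Subfield.smul_def] using h)
    exact ⟨Subtype.ext this.1, Subtype.ext this.2⟩
  have hspan := hli.span_eq_top_of_card_eq_finrank (by simp [hrank])
  have hrep : ∀ z : C, ∃ α ∈ R, ∃ β ∈ R, z = α + β * ε := by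
    intro z
    have hz : z ∈ Submodule.span R (Set.range ![1, ε]) := hspan ▸ Submodule.mem_top
    rw [Matrix.range_cons_cons_empty, Submodule.mem_span_pair] at hz
    obtain ⟨⟨α, hα⟩, ⟨β, hβ⟩, h⟩ := hz
    exact ⟨α, hα, β, hβ, by simpa [Subfield.smul_def] using h.symm⟩
  have hval : ∀ α ∈ R, ∀ β ∈ R, σ (α + β * ε) = α + β * (t - ε) := by
    intro α hα β hβ
    rw [map_add, map_mul, hσR α hα, hσR β hβ, hσε]
  refine ⟨hσR, ?_, ?_, ?_⟩ <;> intro z <;> obtain ⟨α, hα, β, hβ, rfl⟩ := hrep z <;>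
    rw [hval α hα β hβ]
  · have : α + β * ε + (α + β * (t - ε)) = α + α + β * t := by ring
    rw [this]
    exact R.add_mem (R.add_mem hα hα) (R.mul_mem hβ ht)
  · have : (α + β * (t - ε)) * (α + β * ε) = α * α + α * β * t + β * β * d := by
      linear_combination (-β * β) * hmin
    rw [this]
    exact R.add_mem (R.add_mem (R.mul_mem hα hα) (R.mul_mem (R.mul_mem hα hβ) ht))
      (R.mul_mem (R.mul_mem hβ hβ) hd)
  · rw [map_add, map_mul, map_sub, hσR α hα, hσR β hβ, hσR t ht, hσε]
    ring

/-- Every finite subunital of a generalized hermitian unital is a hermitian unital,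
and the embedding is standard: up to a projective transformation `g` of `PG(2,C)`,
it is obtained from an embedding of quadratic field extensions `E|F → C|R`. -/
theorem subunital_is_standard
    {C : Type*} [Field C] (R : Subfield C) (ε t d : C) (σ : C →+* C)
    (hrank : Module.finrank R C = 2)
    (hε : ε ∉ R) (ht : t ∈ R) (hd : d ∈ R)
    (hmin : ε ^ 2 - t * ε + d = 0)
    (hσR : ∀ r ∈ R, σ r = r) (hσε : σ ε = t - ε)
    (q : ℕ) (hq : 2 ≤ q)
    (U : Set (Projectivization C (Fin 3 → C))) (hU : IsSubunital R σ ε q U) :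
    IsPrimePow q ∧
    ∃ (E : Subfield C) (ε' : C) (g : Matrix (Fin 3) (Fin 3) C),
      Nat.card E = q ^ 2 ∧ Nat.card ↥(E ⊓ R) = q ∧
      ε' ∈ E ∧ ε' ∉ R ∧ IsUnit g ∧
      U = {P | ∃ v : Fin 3 → C, (∀ i, v i ∈ E) ∧ v ≠ 0 ∧
            (∃ f ∈ E ⊓ R, v 0 ^ q * v 1 + v 2 ^ (q + 1) = ε' * f) ∧
            ∃ hgv : g.mulVec v ≠ 0, P = Projectivization.mk C (g.mulVec v) hgv} := by
  have hσ := isQuadConj_of_finrank R ε t d σ hrank hε ht hd hmin hσR hσε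
  exact (hU.isLinSubunital hσ).isStandard hσ hε hq
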